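/- arXiv:1510.03479 — 7 statements merged into one kernel-verified Lean document; each statement's English description precedes it below -/
import Mathlib

section
/- Let R be a finite valuation ring with uniformizer z, nilpotency degree r, and residue field of odd cardinality q. Let G be a subgroup of the unit group R^*, let g, h : G → R^* be arbitrary functions, define f(x,y) = g(x)·(h(x)+y) on G × R^*, and let m = μ(x ↦ g(x)·h(x)). Then for all nonempty sets A ⊆ G and B, C ⊆ R^*, one has |f(A,B)| · |B·C| ≥ (1/(8r)) · min{ q^r·|B|/m , |A|·|B|^2·|C| / (m^2·q^{2r-1}) }. -/
open Pointwise

open Classical in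
lemma aux_second {R : Type*} [CommRing R] [Fintype R] (L : Finset (R × R)) :
    ∑ p : R × R, (L.filter (fun l => p.2 = l.1 * p.1 + l.2)).card ^ 2
      ≤ L.card ^ 2 + (Finset.univ.filter (fun x : R => ¬ IsUnit x)).card * Fintype.card R * L.card := by
  set M := (Finset.univ.filter (fun x : R => ¬ IsUnit x)).card with hM
  have h1 : ∀ l ∈ L, ∑ l' ∈ L, (Finset.univ.filter
      (fun x : R => l.1 * x + l.2 = l'.1 * x + l'.2)).card ≤ L.card + M * Fintype.card R := by
    intro l hl
    have e1 : ∀ l' ∈ L, (Finset.univ.filter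
      (fun x : R => l.1 * x + l.2 = l'.1 * x + l'.2)).card ≤
        1 + ∑ x : R, if (¬ IsUnit (l'.1 - l.1) ∧ l.1 * x + l.2 = l'.1 * x + l'.2) then 1 else 0 := by
      intro l' hl'
      by_cases hu : IsUnit (l'.1 - l.1)
      · refine le_trans (Finset.card_le_one.2 ?_) (Nat.le_add_right _ _)
        intro a ha b hb
        simp only [Finset.mem_filter, Finset.mem_univ, true_and] at ha hb
        apply hu.mul_left_cancel
        linear_combination hb - ha
      · simp [hu]
    refine (Finset.sum_le_sum e1).trans ?_
    rw [Finset.sum_add_distrib, Finset.sum_comm]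
    simp only [Finset.sum_const, smul_eq_mul, mul_one]
    gcongr
    have e2 : ∀ x ∈ (Finset.univ : Finset R), (∑ l' ∈ L, if (¬ IsUnit (l'.1 - l.1) ∧ l.1 * x + l.2 = l'.1 * x + l'.2) then 1 else 0) ≤ M := by
      intro x _
      rw [← Finset.card_filter, hM]
      apply Finset.card_le_card_of_injOn (fun l' => l'.1 - l.1)
      · intro l' hl'
        simp at hl' ⊢
        exact hl'.2.1
      · intro a ha b hb hab
        simp at ha hb hab
        apply Prod.ext hab
        have h1 := ha.2.2
        have h2 := hb.2.2
        linear_combination h2 - h1 - x * hab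
    refine (Finset.sum_le_sum e2).trans ?_
    simp [mul_comm]
  have h2 : ∑ p : R × R, (L.filter (fun l => p.2 = l.1 * p.1 + l.2)).card ^ 2 =
      ∑ l ∈ L, ∑ l' ∈ L, (Finset.univ.filter
      (fun x : R => l.1 * x + l.2 = l'.1 * x + l'.2)).card := by
    simp only [Finset.card_filter, sq, Finset.sum_mul_sum]
    rw [Finset.sum_comm]
    refine Finset.sum_congr rfl fun l _ => ?_
    rw [Finset.sum_comm]
    refine Finset.sum_congr rfl fun l' _ => ?_
    rw [Fintype.sum_prod_type]
    refine Finset.sum_congr rfl fun x _ => ?_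
    simp
    grind
  rw [h2]
  refine (Finset.sum_le_sum h1).trans (le_of_eq ?_)
  simp
  ring

open Classical in
lemma aux_first {R : Type*} [CommRing R] [Fintype R] (L : Finset (R × R)) :
    ∑ p : R × R, (L.filter (fun l => p.2 = l.1 * p.1 + l.2)).card = Fintype.card R * L.card := by
  simp only [Finset.card_filter]
  rw [Finset.sum_comm]
  simp only [Fintype.sum_prod_type]
  simp [mul_comm]

open Classical in
lemma aux_inc {R : Type*} [CommRing R] [Fintype R] [Nontrivial R] (L P : Finset (R × R)) (b : ℝ) (hb : 0 ≤ b)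
    (hL : 0 < L.card)
    (H : ∀ l ∈ L, b ≤ (P.filter (fun p => p.2 = l.1 * p.1 + l.2)).card) :
    (Fintype.card R : ℝ) * b / 2 ≤ P.card ∨ b ^ 2 * L.card ≤
      4 * (P.card * ((Finset.univ.filter (fun x : R => ¬ IsUnit x)).card * Fintype.card R : ℝ)) := by
  by_contra! hcon
  obtain ⟨c1, c2⟩ := hcon
  set n : ℝ := ((Fintype.card R : ℕ) : ℝ) with hn
  have hn0 : 0 < n := by rw [hn]; exact_mod_cast Fintype.card_pos
  set M : ℝ := (((Finset.univ.filter (fun x : R => ¬ IsUnit x)).card : ℕ) : ℝ) with hM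
  set k : ℝ := ((L.card : ℕ) : ℝ) with hk
  have hk0 : 0 < k := by rw [hk]; exact_mod_cast hL
  let N : R × R → ℝ := fun p => (L.filter (fun l => p.2 = l.1 * p.1 + l.2)).card
  have s1 : ∑ p, N p = n * k := by
    have := aux_first L
    simp only [N, hn, hk]; exact_mod_cast this
  have s2 : ∑ p, N p ^ 2 ≤ k ^ 2 + M * n * k := by
    have := aux_second L
    simp only [N, hn, hk, hM]; exact_mod_cast this
  have s3 : b * k ≤ ∑ p ∈ P, N p := by
    have : ∑ p ∈ P, N p = ∑ l ∈ L, ((P.filter (fun p => p.2 = l.1 * p.1 + l.2)).card : ℝ) := by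
      simp only [N, Finset.card_filter, Nat.cast_sum]
      rw [Finset.sum_comm]
    rw [this]
    refine le_trans (le_of_eq ?_) (Finset.sum_le_sum H)
    simp [hk, mul_comm]
  have s4 : ∑ p, (N p - k / n) ^ 2 ≤ M * n * k := by
    have : ∑ p, (N p - k / n) ^ 2 = ∑ p, N p ^ 2 - 2 * (k / n) * ∑ p, N p + n ^ 2 * (k / n) ^ 2 := by
      simp only [sub_sq, Finset.sum_add_distrib, Finset.sum_sub_distrib, Finset.mul_sum]
      congr 1
      · congr 1
        exact Finset.sum_congr rfl fun _ _ => by ring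
      · simp only [Finset.sum_const, Finset.card_univ, Fintype.card_prod, nsmul_eq_mul, Nat.cast_mul]
        rw [← hn]; ring
    rw [this, s1]
    have : 2 * (k / n) * (n * k) = 2 * k ^ 2 := by field_simp
    rw [this]
    have : n ^ 2 * (k / n) ^ 2 = k ^ 2 := by field_simp
    rw [this]; linarith
  have s5 : (∑ p ∈ P, (N p - k / n)) ^ 2 ≤ P.card * (M * n * k) := by
    refine sq_sum_le_card_mul_sum_sq.trans ?_
    gcongr
    refine le_trans ?_ s4
    exact Finset.sum_le_sum_of_subset_of_nonneg (Finset.subset_univ _) (fun _ _ _ => sq_nonneg _)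
  have s6 : b * k / 2 ≤ ∑ p ∈ P, (N p - k / n) := by
    rw [Finset.sum_sub_distrib]
    simp only [Finset.sum_const, nsmul_eq_mul]
    have : (P.card : ℝ) * (k / n) ≤ b * k / 2 := by
      rw [← mul_div_assoc, div_le_iff₀ hn0]
      nlinarith
    linarith
  have s7 : (b * k / 2) ^ 2 ≤ P.card * (M * n * k) :=
    le_trans (by gcongr) s5
  nlinarith

lemma aux_card {R : Type*} [CommRing R] [Fintype R] [IsLocalRing R]
    (z : R) (hz : IsLocalRing.maximalIdeal R = Ideal.span {z})
    (r : ℕ) (hzr : z ^ r = 0) (hmin : ∀ k < r, z ^ k ≠ 0)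
    (q : ℕ) (hq : Nat.card (IsLocalRing.ResidueField R) = q) :
    Nat.card R = q * Nat.card (IsLocalRing.maximalIdeal R) ∧ Nat.card R = q ^ r := by
  have hR : Nat.card R = q * Nat.card (IsLocalRing.maximalIdeal R) := by
    rw [← hq, mul_comm]
    exact Submodule.card_eq_card_quotient_mul_card (IsLocalRing.maximalIdeal R)
  refine ⟨hR, ?_⟩
  let f : R →ₗ[R] R := LinearMap.mulLeft R z
  have hker_q : Nat.card (LinearMap.ker f) = q := by
    have h1 := Submodule.card_eq_card_quotient_mul_card (LinearMap.ker f)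
    rw [Nat.card_congr f.quotKerEquivRange.toEquiv] at h1
    have h2 : LinearMap.range f = IsLocalRing.maximalIdeal R := by
      rw [hz]; ext x
      simp [f, Ideal.mem_span_singleton, dvd_def, eq_comm]
    rw [h2] at h1
    have h3 : 0 < Nat.card (IsLocalRing.maximalIdeal R) := Nat.card_pos
    have h4 := h1.symm.trans hR
    nlinarith [Nat.eq_of_mul_eq_mul_right h3 (by linarith : Nat.card (LinearMap.ker f) * Nat.card (IsLocalRing.maximalIdeal R) = q * Nat.card (IsLocalRing.maximalIdeal R))]
  have hrep : ∀ x : R, z * x = 0 → ∀ k < r, z ^ k ∣ x := by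
    intro x hx k
    induction k with
    | zero => intro _; simp
    | succ k ih =>
      intro hk
      obtain ⟨y, rfl⟩ := ih (by omega)
      by_cases hy : IsUnit y
      · exfalso
        apply hmin (k+1) hk
        apply hy.mul_right_cancel
        rw [zero_mul, ← hx]; ring
      · have : y ∈ IsLocalRing.maximalIdeal R := hy
        rw [hz, Ideal.mem_span_singleton] at this
        obtain ⟨w, rfl⟩ := this
        exact ⟨w, by ring⟩
  have hstep : ∀ k < r, Nat.card (Ideal.span {z ^ k}) = q * Nat.card (Ideal.span {z ^ (k+1)}) := by
    intro k hk
    let I : Submodule R R := Ideal.span {z ^ k}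
    let F : I →ₗ[R] R := f.comp I.subtype
    have h1 := Submodule.card_eq_card_quotient_mul_card (LinearMap.ker F)
    rw [Nat.card_congr F.quotKerEquivRange.toEquiv] at h1
    have h2 : LinearMap.range F = Ideal.span {z ^ (k+1)} := by
      ext x
      simp only [F, f, I, LinearMap.mem_range, LinearMap.comp_apply, Submodule.subtype_apply, LinearMap.mulLeft_apply, Subtype.exists, Ideal.mem_span_singleton]
      constructor
      · rintro ⟨a, ⟨c, rfl⟩, rfl⟩
        exact ⟨c, by ring⟩
      · rintro ⟨c, rfl⟩
        exact ⟨z ^ k * c, ⟨c, rfl⟩, by ring⟩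
    have h3 : Nat.card (LinearMap.ker F) = q := by
      rw [← hker_q]
      refine Nat.card_congr ⟨fun x => ⟨x.1.1, x.2⟩, fun x => ⟨⟨x.1, ?_⟩, x.2⟩, fun _ => rfl, fun _ => rfl⟩
      exact Ideal.mem_span_singleton.2 (hrep x.1 x.2 k hk)
    rw [h2, h3] at h1
    exact h1
  have hall : ∀ k ≤ r, Nat.card R = q ^ k * Nat.card (Ideal.span {z ^ k}) := by
    intro k
    induction k with
    | zero =>
      intro _
      simp [Ideal.span_singleton_one]
    | succ k ih =>
      intro hk
      rw [ih (by omega), hstep k (by omega)]; ring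
  have := hall r le_rfl
  rw [hzr] at this
  rw [this]; simp

/-- **Theorem 1.8 (generalization of Hegyvári–Hennecart to finite valuation rings).**
Let `R` be a finite valuation ring (finite, local, principal commutative ring) with
uniformizer `z`, nilpotency degree `r`, residue field of odd cardinality `q`.  Let `G`
be a subgroup of `Rˣ`, `g h : G → Rˣ` arbitrary functions, `f (x, y) = g x * (h x + y)`,
and `m = μ(g ⬝ h)`.  For all nonempty `A ⊆ G`, `B, C ⊆ Rˣ`,
`|f(A,B)| * |B⬝C| ≥ (1/(8r)) * min (qʳ|B|/m) (|A||B|²|C|/(m² q^{2r-1}))`. -/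
theorem stmt_0 {R : Type*} [CommRing R] [Fintype R] [IsLocalRing R] [IsPrincipalIdealRing R]
    (z : R) (hz : IsLocalRing.maximalIdeal R = Ideal.span {z})
    (r : ℕ) (hzr : z ^ r = 0) (hmin : ∀ k < r, z ^ k ≠ 0)
    (q : ℕ) (hq : Nat.card (IsLocalRing.ResidueField R) = q) (hqodd : Odd q)
    (G : Subgroup Rˣ) (g h : G → Rˣ)
    (m : ℕ) (hm : m = ⨆ t : Rˣ, Nat.card {x : G // g x * h x = t})
    (A : Set G) (B C : Set Rˣ) (hA : A.Nonempty) (hB : B.Nonempty) (hC : C.Nonempty) :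
    (Nat.card (Set.image2 (fun (x : G) (y : Rˣ) => (g x : R) * ((h x : R) + (y : R))) A B) : ℝ)
        * (Nat.card (B * C) : ℝ) ≥
      1 / (8 * (r : ℝ)) *
        min ((q : ℝ) ^ r * (Nat.card B : ℝ) / (m : ℝ))
          ((Nat.card A : ℝ) * (Nat.card B : ℝ) ^ 2 * (Nat.card C : ℝ)
            / ((m : ℝ) ^ 2 * (q : ℝ) ^ (2 * r - 1))) := by
  classical
  obtain ⟨hR1, hR2⟩ := aux_card z hz r hzr hmin q hq
  have hr : 0 < r := by
    rcases Nat.eq_zero_or_pos r with h0 | h0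
    · subst h0; simp at hzr
    · exact h0
  have hq0 : 0 < q := hqodd.pos
  have hM : Nat.card (IsLocalRing.maximalIdeal R) = q ^ (r - 1) := by
    apply Nat.eq_of_mul_eq_mul_left hq0
    rw [← hR1, hR2, ← pow_succ']
    congr 1; omega
  have hM' : (Finset.univ.filter (fun x : R => ¬ IsUnit x)).card = q ^ (r - 1) := by
    rw [← hM, ← Fintype.card_subtype, ← Nat.card_eq_fintype_card]
    exact Nat.card_congr (Equiv.refl _)
  rw [Nat.card_eq_fintype_card] at hR2
  have hmle : ∀ t : Rˣ, Nat.card {x : G // g x * h x = t} ≤ m := by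
    intro t; rw [hm]
    exact le_ciSup (f := fun t : Rˣ => Nat.card {x : G // g x * h x = t})
      (Set.finite_range _).bddAbove t
  have hm1 : 1 ≤ m := by
    obtain ⟨a, _⟩ := hA
    refine le_trans ?_ (hmle (g a * h a))
    have : Nonempty {x : G // g x * h x = g a * h a} := ⟨⟨a, rfl⟩⟩
    exact Nat.card_pos
  set S : Set R := Set.image2 (fun (x : G) (y : Rˣ) => (g x : R) * ((h x : R) + (y : R))) A B with hS
  set T : Set Rˣ := B * C with hT
  let φ : G × Rˣ → R × R := fun x => (((g x.1 * x.2⁻¹ : Rˣ) : R), ((g x.1 * h x.1 : Rˣ) : R))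
  let AC : Finset (G × Rˣ) := A.toFinset ×ˢ C.toFinset
  let L : Finset (R × R) := AC.image φ
  let P : Finset (R × R) := (T.toFinset.image (fun t : Rˣ => (t : R))) ×ˢ S.toFinset
  have hPc : P.card = Nat.card T * Nat.card S := by
    simp only [P, Finset.card_product, Nat.card_eq_fintype_card, Set.toFinset_card]
    rw [Finset.card_image_of_injective _ Units.val_injective, Set.toFinset_card]
  have hACc : AC.card = Nat.card A * Nat.card C := by
    simp only [AC, Finset.card_product, Nat.card_eq_fintype_card, Set.toFinset_card]
  have hLc : AC.card ≤ m * L.card := by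
    apply Finset.card_le_mul_card_image
    rintro ⟨u, v⟩ hp
    obtain ⟨⟨a0, c0⟩, _, h0⟩ := Finset.mem_image.1 hp
    refine le_trans ?_ (hmle (g a0 * h a0))
    rw [Nat.card_eq_fintype_card, Fintype.card_subtype]
    apply Finset.card_le_card_of_injOn (fun x => x.1)
    · rintro ⟨a, c⟩ hx
      simp only [Finset.coe_filter, Set.mem_ofPred_eq, Finset.mem_univ, true_and] at hx ⊢
      have := hx.2.trans h0.symm
      exact Units.ext (congrArg Prod.snd this)
    · rintro ⟨a, c⟩ hx ⟨a', c'⟩ hx' haa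
      simp only [Finset.coe_filter, Set.mem_ofPred_eq] at hx hx' haa
      subst haa
      have : g a * c⁻¹ = g a * c'⁻¹ :=
        Units.ext (congrArg Prod.fst (hx.2.trans hx'.2.symm))
      simpa using this
  have hACpos : 0 < AC.card := by
    apply Finset.card_pos.2
    exact (Set.toFinset_nonempty.2 hA).product (Set.toFinset_nonempty.2 hC)
  have hL0 : 0 < L.card := by
    by_contra hcon
    have : L.card = 0 := by omega
    rw [this] at hLc; omega
  have H : ∀ l ∈ L, ((Nat.card B : ℕ) : ℝ) ≤ (P.filter (fun p => p.2 = l.1 * p.1 + l.2)).card := by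
    intro l hl
    obtain ⟨⟨a, c⟩, hac, rfl⟩ := Finset.mem_image.1 hl
    have hac' : a ∈ A ∧ c ∈ C := by simpa [AC] using hac
    refine Nat.cast_le.2 ?_
    rw [Nat.card_eq_fintype_card, ← Set.toFinset_card]
    refine Finset.card_le_card_of_injOn
      (fun b : Rˣ => (((b * c : Rˣ) : R), (g a : R) * ((h a : R) + (b : R)))) ?_ ?_
    · intro b hb
      have hb' : b ∈ B := by simpa using hb
      have k1 : b * c ∈ T := Set.mul_mem_mul hb' hac'.2
      have k2 : (g a : R) * ((h a : R) + (b : R)) ∈ S := Set.mem_image2_of_mem hac'.1 hb'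
      rw [Finset.mem_coe, Finset.mem_filter]
      refine ⟨Finset.mem_product.2 ⟨Finset.mem_image.2 ⟨b * c, by simpa using k1, rfl⟩, by simpa using k2⟩, ?_⟩
      have k3 : ((c⁻¹ : Rˣ) : R) * (c : R) = 1 := Units.inv_mul c
      simp only [φ, Units.val_mul]
      linear_combination (-(g a : R) * b) * k3
    · intro b _ b' _ hbb
      have : b * c = b' * c := Units.ext (congrArg Prod.fst hbb)
      exact mul_right_cancel this
  have hB0 : (0 : ℝ) ≤ ((Nat.card B : ℕ) : ℝ) := Nat.cast_nonneg _
  have key := aux_inc L P _ hB0 hL0 H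
  rw [hPc, hM', hR2] at key
  rw [hACc] at hLc
  have hLc' : (Nat.card A : ℝ) * Nat.card C ≤ m * L.card := by exact_mod_cast hLc
  have hm1' : (1 : ℝ) ≤ m := by exact_mod_cast hm1
  have hr' : (1 : ℝ) ≤ r := by exact_mod_cast hr
  have hq' : (0 : ℝ) < q := by exact_mod_cast hq0
  have hqq : (q : ℝ) ^ (r - 1) * (q : ℝ) ^ r = (q : ℝ) ^ (2 * r - 1) := by
    rw [← pow_add]; congr 1; omega
  push_cast at key
  rw [hqq] at key
  generalize (Nat.card B : ℝ) = b at *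
  generalize (Nat.card A : ℝ) = a at *
  generalize (Nat.card C : ℝ) = c at *
  generalize (Nat.card S : ℝ) = s at *
  generalize (Nat.card T : ℝ) = t at *
  have hk0 : (0 : ℝ) ≤ L.card := Nat.cast_nonneg _
  generalize (L.card : ℝ) = k at *
  have hQ : (0 : ℝ) < (q : ℝ) ^ (2 * r - 1) := by positivity
  have hQ' : (0 : ℝ) < (q : ℝ) ^ r := by positivity
  generalize (q : ℝ) ^ (2 * r - 1) = Q at *
  generalize (q : ℝ) ^ r = n at *
  generalize (m : ℝ) = μ at *
  generalize (r : ℝ) = ρ at *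
  have hμ0 : 0 < μ := by linarith
  have hρ0 : 0 < ρ := by linarith
  rw [ge_iff_le]
  rcases key with key | key
  · have h1 : 1 / (8 * ρ) * (n * b / μ) ≤ s * t := by
      have e1 : n * b / μ ≤ n * b := div_le_self (by positivity) hm1'
      have e2 : 1 / (8 * ρ) ≤ 1 / 2 := by
        apply one_div_le_one_div_of_le <;> linarith
      have e3 : 1 / (8 * ρ) * (n * b / μ) ≤ 1 / 2 * (n * b) := by
        apply mul_le_mul e2 e1 <;> positivity
      linarith
    refine le_trans ?_ h1
    exact mul_le_mul_of_nonneg_left (min_le_left _ _) (by positivity)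
  · have h1 : 1 / (8 * ρ) * (a * b ^ 2 * c / (μ ^ 2 * Q)) ≤ s * t := by
      have e0 : 0 ≤ t * s := by
        by_contra! hneg
        have : t * s * Q < 0 := mul_neg_of_neg_of_pos hneg hQ
        have hk : 0 ≤ b ^ 2 * k := by
          positivity
        linarith
      rw [← mul_div_assoc, div_le_iff₀ (by positivity), one_div, inv_mul_le_iff₀ (by positivity)]
      have e1 : a * b ^ 2 * c ≤ μ * (b ^ 2 * k) := by
        have := mul_le_mul_of_nonneg_left hLc' (sq_nonneg b)
        linarith
      have e2 : μ * (b ^ 2 * k) ≤ μ * (4 * (t * s * Q)) := by gcongr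
      have e3 : μ * (4 * (t * s * Q)) ≤ (ρ * μ) * (μ * (4 * (t * s * Q))) := by
        apply le_mul_of_one_le_left (by positivity)
        nlinarith
      have e4 : (ρ * μ) * (μ * (4 * (t * s * Q))) ≤ (8 * ρ) * (s * t * (μ ^ 2 * Q)) := by
        have : 0 ≤ ρ * μ * μ * (t * s * Q) := by positivity
        linarith
      linarith
    refine le_trans ?_ h1
    exact mul_le_mul_of_nonneg_left (min_le_right _ _) (by positivity)
end

section
/- Let R be a finite valuation ring with uniformizer z, nilpotency degree r, and residue field of odd cardinality q. For any nonempty set A ⊆ R such that every element of A is a unit and every element of A+1 = {a+1 : a ∈ A} is a unit, one has |A·(A+1)|^2 ≥ (1/(8r)) · min{ q^r·|A| , |A|^4 / q^{2r-1} }. -/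
open Pointwise

namespace FVR

open Classical in
noncomputable def cnt {R : Type*} [CommRing R] (E : Finset (R × R)) (f : R × R) : ℕ :=
  (E.filter (fun e => e.1 * f.1 - e.2 * f.2 = 1)).card

open Classical in
theorem line_card {R : Type*} [CommRing R] [Fintype R] (e : R × R) (he : IsUnit e.1) :
    (Finset.univ.filter (fun f : R × R => e.1 * f.1 - e.2 * f.2 = 1)).card = Fintype.card R := by
  obtain ⟨u, hu⟩ := he
  rw [← Finset.card_univ]
  refine Finset.card_bij' (fun f _ => f.2) (fun y _ => (↑u⁻¹ * (1 + e.2 * y), y)) ?_ ?_ ?_ ?_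
  · simp
  · intro y _
    simp [← hu]
  · rintro ⟨x, y⟩ h
    simp only [Finset.mem_filter, Finset.mem_univ, true_and] at h
    simp only [Prod.mk.injEq, and_true]
    have : 1 + e.2 * y = u * x := by rw [hu]; linear_combination -h
    rw [this]; simp
  · simp

theorem sum_cnt {R : Type*} [CommRing R] [Fintype R] (E : Finset (R × R))
    (hE : ∀ e ∈ E, IsUnit e.1) :
    ∑ f, cnt E f = E.card * Fintype.card R := by
  classical
  simp only [cnt, Finset.card_filter]
  rw [Finset.sum_comm, ← smul_eq_mul, ← Finset.sum_const]
  refine Finset.sum_congr rfl fun e he => ?_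
  rw [← line_card e (hE e he), Finset.card_filter]

open Classical in
theorem pair_unit {R : Type*} [CommRing R] [Fintype R] (e e' : R × R)
    (h : IsUnit (e.1 * e'.2 - e.2 * e'.1)) :
    (Finset.univ.filter (fun f : R × R =>
      e.1 * f.1 - e.2 * f.2 = 1 ∧ e'.1 * f.1 - e'.2 * f.2 = 1)).card ≤ 1 := by
  rw [Finset.card_le_one]
  rintro ⟨a, b⟩ h1 ⟨c, d⟩ h2
  simp only [Finset.mem_filter, Finset.mem_univ, true_and] at h1 h2
  obtain ⟨h1, h1'⟩ := h1
  obtain ⟨h2, h2'⟩ := h2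
  ext
  · apply h.mul_left_cancel
    linear_combination e'.2 * (h1 - h2) - e.2 * (h1' - h2')
  · apply h.mul_left_cancel
    linear_combination e'.1 * (h1 - h2) - e.1 * (h1' - h2')

open Classical in
theorem nonunit_count {R : Type*} [CommRing R] [Fintype R] (E : Finset (R × R)) (e : R × R)
    (he : IsUnit e.1) :
    ((E ×ˢ (Finset.univ : Finset (R × R))).filter (fun p => (¬ IsUnit (e.1 * p.1.2 - e.2 * p.1.1)) ∧
      e.1 * p.2.1 - e.2 * p.2.2 = 1 ∧ p.1.1 * p.2.1 - p.1.2 * p.2.2 = 1)).card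
      ≤ Fintype.card R * (Finset.univ.filter (fun x : R => ¬ IsUnit x)).card := by
  rw [← Finset.card_univ, ← Finset.card_product]
  refine Finset.card_le_card_of_injOn (fun p => (p.2.2, e.1 * p.1.2 - e.2 * p.1.1)) ?_ ?_
  · intro p hp
    simp only [Finset.coe_filter, Set.mem_ofPred_eq] at hp
    simp [hp.2.1]
  · rintro ⟨⟨a, b⟩, ⟨x, y⟩⟩ h1 ⟨⟨c, d⟩, ⟨x', y'⟩⟩ h2 heq
    simp only [Finset.coe_filter, Set.mem_ofPred_eq] at h1 h2
    simp only [Prod.mk.injEq] at heq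
    obtain ⟨rfl, hd⟩ := heq
    obtain ⟨-, -, h3, h4⟩ := h1
    obtain ⟨-, -, h5, h6⟩ := h2
    have hx : x = x' := by
      apply he.mul_left_cancel
      linear_combination h3 - h5
    subst hx
    have ha : a = c := by
      linear_combination e.1 * (h4 - h6) + y * hd - (a - c) * h3
    have hb : b = d := by
      linear_combination e.2 * (h4 - h6) + x * hd - (b - d) * h3
    rw [ha, hb]

open Classical in
theorem sum_sq {R : Type*} [CommRing R] [Fintype R] (E : Finset (R × R))
    (hE : ∀ e ∈ E, IsUnit e.1) :
    ∑ f, cnt E f ^ 2 ≤ E.card * (E.card +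
      Fintype.card R * (Finset.univ.filter (fun x : R => ¬ IsUnit x)).card) := by
  have h1 : ∑ f, cnt E f ^ 2 = ∑ e ∈ E, ∑ e' ∈ E, (Finset.univ.filter (fun f : R × R =>
      e.1 * f.1 - e.2 * f.2 = 1 ∧ e'.1 * f.1 - e'.2 * f.2 = 1)).card := by
    simp only [cnt, Finset.card_filter, sq, Finset.sum_mul_sum]
    rw [Finset.sum_comm]
    refine Finset.sum_congr rfl fun e _ => ?_
    rw [Finset.sum_comm]
    refine Finset.sum_congr rfl fun e' _ => ?_
    refine Finset.sum_congr rfl fun f _ => ?_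
    by_cases ha : e.1 * f.1 - e.2 * f.2 = 1 <;> simp [ha]
  rw [h1, ← smul_eq_mul]
  refine Finset.sum_le_card_nsmul _ _ _ fun e he => ?_
  have h2 := nonunit_count E e (hE e he)
  refine le_trans ?_ (Nat.add_le_add_left h2 _)
  rw [Finset.card_filter, Finset.sum_product, Finset.card_eq_sum_ones, ← Finset.sum_add_distrib]
  refine Finset.sum_le_sum fun e' _ => ?_
  by_cases hu : IsUnit (e.1 * e'.2 - e.2 * e'.1)
  · exact le_trans (pair_unit e e' hu) (Nat.le_add_right _ _)
  · simp only [hu, not_false_eq_true, true_and, Finset.card_filter]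
    exact Nat.le_add_left _ _

open Classical in
theorem variance {R : Type*} [CommRing R] [Fintype R] [Nontrivial R] (E : Finset (R × R))
    (hE : ∀ e ∈ E, IsUnit e.1) :
    ∑ f, ((cnt E f : ℝ) - E.card / Fintype.card R) ^ 2 ≤ E.card *
      (Fintype.card R * (Finset.univ.filter (fun x : R => ¬ IsUnit x)).card) := by
  have h1 : (∑ f, (cnt E f : ℝ)) = E.card * Fintype.card R := by exact_mod_cast sum_cnt E hE
  have h2 : (∑ f, (cnt E f : ℝ) ^ 2) ≤ E.card * (E.card +
      Fintype.card R * (Finset.univ.filter (fun x : R => ¬ IsUnit x)).card) := by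
    exact_mod_cast sum_sq E hE
  have hQ : (Fintype.card R : ℝ) ≠ 0 := by exact_mod_cast Fintype.card_ne_zero
  simp only [sub_sq, Finset.sum_add_distrib, Finset.sum_sub_distrib]
  rw [← Finset.sum_mul, ← Finset.mul_sum, h1, Finset.sum_const, Finset.card_univ,
    Fintype.card_prod, nsmul_eq_mul]
  have h3 : 2 * ((E.card : ℝ) * Fintype.card R) * (E.card / Fintype.card R) = 2 * E.card ^ 2 := by
    field_simp
  have h4 : ((Fintype.card R * Fintype.card R : ℕ) : ℝ) * ((E.card : ℝ) / Fintype.card R) ^ 2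
      = E.card ^ 2 := by
    push_cast; field_simp
  rw [h3, h4]
  linarith

theorem main {R : Type*} [CommRing R] [Fintype R] [Nontrivial R] (A P : Finset R)
    (hA : A.Nonempty)
    (hAu : ∀ a ∈ A, IsUnit a) (hA1u : ∀ a ∈ A, IsUnit (a + 1))
    (hP : ∀ a ∈ A, ∀ b ∈ A, a * (b + 1) ∈ P) (hPu : ∀ p ∈ P, IsUnit p) (K : ℝ) (hK : 0 < K)
    (hM : (Fintype.card R : ℝ) * Nat.card {x : R // ¬ IsUnit x} = K) :
    (Fintype.card R : ℝ) * A.card / 2 ≤ (P.card : ℝ) ^ 2 ∨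
      (A.card : ℝ) ^ 4 / (4 * K) ≤ (P.card : ℝ) ^ 2 := by
  classical
  rw [Nat.card_eq_fintype_card, Fintype.card_subtype] at hM
  set E : Finset (R × R) := P ×ˢ P with hEdef
  have hE : ∀ e ∈ E, IsUnit e.1 := by
    intro e he
    exact hPu _ (Finset.mem_product.1 he).1
  have hEc : (E.card : ℝ) = (P.card : ℝ) ^ 2 := by
    rw [hEdef, Finset.card_product]; push_cast; ring
  set g : R × R → R × R := fun p => (Ring.inverse p.1, Ring.inverse (p.2 + 1)) with hg
  have hinj : Set.InjOn g (A ×ˢ A : Finset (R × R)) := by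
    rintro ⟨a, c⟩ h ⟨b, d⟩ h' heq
    simp only [Finset.coe_product, Set.mem_prod, Finset.mem_coe] at h h'
    simp only [hg, Prod.mk.injEq] at heq
    have h1 := Ring.mul_inverse_cancel _ (hAu a h.1)
    have h2 := Ring.mul_inverse_cancel _ (hAu b h'.1)
    have h3 := Ring.mul_inverse_cancel _ (hA1u c h.2)
    have h4 := Ring.mul_inverse_cancel _ (hA1u d h'.2)
    rw [heq.1] at h1
    rw [heq.2] at h3
    ext
    · show a = b
      linear_combination b * h1 - a * h2
    · show c = d
      linear_combination (d + 1) * h3 - (c + 1) * h4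
  set F := (A ×ˢ A).image g with hF
  have hFc : F.card = A.card ^ 2 := by
    rw [hF, Finset.card_image_of_injOn hinj, Finset.card_product, sq]
  have hlow : ∀ f ∈ F, A.card ≤ cnt E f := by
    intro f hf
    obtain ⟨⟨a, c⟩, hac, rfl⟩ := Finset.mem_image.1 hf
    obtain ⟨ha, hc⟩ := Finset.mem_product.1 hac
    have h1 := Ring.mul_inverse_cancel _ (hAu a ha)
    have h3 := Ring.mul_inverse_cancel _ (hA1u c hc)
    refine Finset.card_le_card_of_injOn (fun b => (a * (b + 1), b * (c + 1))) ?_ ?_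
    · intro b hb
      simp only [Finset.coe_filter, Set.mem_ofPred_eq, hEdef, Finset.mem_product]
      refine ⟨⟨hP a ha b hb, hP b hb c hc⟩, ?_⟩
      simp only [hg]
      linear_combination (b + 1) * h1 - b * h3
    · intro b _ b' _ h
      simp only [Prod.mk.injEq] at h
      have := (hAu a ha).mul_left_cancel h.1
      simpa using this
  have hvar := variance E hE
  set μ : ℝ := (E.card : ℝ) / Fintype.card R with hμ
  have hcs : (∑ f ∈ F, ((cnt E f : ℝ) - μ)) ^ 2 ≤ F.card * ∑ f ∈ F, ((cnt E f : ℝ) - μ) ^ 2 :=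
    sq_sum_le_card_mul_sum_sq
  have hsub : ∑ f ∈ F, ((cnt E f : ℝ) - μ) ^ 2 ≤ ∑ f, ((cnt E f : ℝ) - μ) ^ 2 :=
    Finset.sum_le_sum_of_subset_of_nonneg (Finset.subset_univ _) fun _ _ _ => sq_nonneg _
  have hQ : (0 : ℝ) < Fintype.card R := by exact_mod_cast Fintype.card_pos
  have hn : (0 : ℝ) < A.card := by exact_mod_cast hA.card_pos
  have hFr : (F.card : ℝ) = (A.card : ℝ) ^ 2 := by rw [hFc]; push_cast; rfl
  rw [hM] at hvar
  have htot : (A.card : ℝ) ^ 2 * (A.card - μ) ≤ ∑ f ∈ F, ((cnt E f : ℝ) - μ) := by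
    rw [← hFr, ← nsmul_eq_mul]
    refine Finset.card_nsmul_le_sum _ _ _ fun f hf => ?_
    have : (A.card : ℝ) ≤ cnt E f := by exact_mod_cast hlow f hf
    linarith
  by_cases hc : (Fintype.card R : ℝ) * A.card / 2 ≤ (P.card : ℝ) ^ 2
  · exact Or.inl hc
  right
  push Not at hc
  have hμ2 : μ ≤ A.card / 2 := by
    rw [hμ, hEc, div_le_iff₀ hQ]; linarith
  have h5 : (A.card : ℝ) ^ 3 / 2 ≤ ∑ f ∈ F, ((cnt E f : ℝ) - μ) := by
    refine le_trans ?_ htot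
    nlinarith [sq_nonneg (A.card : ℝ), mul_le_mul_of_nonneg_left hμ2 (sq_nonneg (A.card : ℝ))]
  have h6 : ((A.card : ℝ) ^ 3 / 2) ^ 2 ≤ (A.card : ℝ) ^ 2 * ((P.card : ℝ) ^ 2 * K) := by
    calc _ ≤ (∑ f ∈ F, ((cnt E f : ℝ) - μ)) ^ 2 := pow_le_pow_left₀ (by positivity) h5 2
      _ ≤ _ := hcs
      _ ≤ (A.card : ℝ) ^ 2 * ((P.card : ℝ) ^ 2 * K) := by
        rw [hFr, ← hEc]
        exact mul_le_mul_of_nonneg_left (hsub.trans hvar) (by positivity)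
  rw [div_le_iff₀ (by positivity)]
  have h7 : (A.card : ℝ) ^ 2 * (A.card : ℝ) ^ 4 ≤ (A.card : ℝ) ^ 2 * ((P.card : ℝ) ^ 2 * (4 * K)) := by
    nlinarith
  exact le_of_mul_le_mul_left h7 (by positivity)

theorem index_pow {R : Type*} [CommRing R] [Fintype R] [IsLocalRing R]
    (z : R) (hz : IsLocalRing.maximalIdeal R = Ideal.span {z})
    (r : ℕ) (hmin : ∀ k < r, z ^ k ≠ 0) (k : ℕ) (hk : k ≤ r) :
    (Ideal.span {z ^ k}).toAddSubgroup.index = (Nat.card (IsLocalRing.ResidueField R)) ^ k := by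
  induction k with
  | zero =>
    simp [Ideal.span_singleton_one]
  | succ k ih =>
    have hle : (Ideal.span {z ^ (k+1)}).toAddSubgroup ≤ (Ideal.span {z ^ k}).toAddSubgroup := by
      intro x hx
      have hx : x ∈ Ideal.span {z ^ (k+1)} := hx
      show x ∈ Ideal.span {z ^ k}
      rw [Ideal.mem_span_singleton] at *
      exact (pow_dvd_pow z (Nat.le_succ k)).trans hx
    rw [← AddSubgroup.relIndex_mul_index hle, ih (by omega), pow_succ, mul_comm]
    congr 1
    have hr : (AddMonoidHom.mulLeft (z ^ k)).range = (Ideal.span {z ^ k}).toAddSubgroup := by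
      ext x
      show _ ↔ x ∈ Ideal.span {z ^ k}
      rw [Ideal.mem_span_singleton]
      constructor
      · rintro ⟨y, rfl⟩
        exact Dvd.intro _ rfl
      · rintro ⟨y, rfl⟩
        exact ⟨y, rfl⟩
    have hc : (Ideal.span {z ^ (k+1)}).toAddSubgroup.comap (AddMonoidHom.mulLeft (z ^ k))
        = (IsLocalRing.maximalIdeal R).toAddSubgroup := by
      ext x
      show z ^ k * x ∈ Ideal.span {z ^ (k+1)} ↔ x ∈ IsLocalRing.maximalIdeal R
      constructor
      · intro h
        by_contra hx
        have hxu : IsUnit x := by simpa using hx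
        rw [Ideal.mem_span_singleton] at h
        obtain ⟨y, hy⟩ := h
        obtain ⟨u, rfl⟩ := hxu
        have h1 : z ^ k * (u - z * y) = 0 := by linear_combination hy
        have hzm : z * y ∈ IsLocalRing.maximalIdeal R := by
          rw [hz]; exact Ideal.mul_mem_right _ _ (Ideal.mem_span_singleton_self z)
        have h2 : IsUnit ((u : R) - z * y) := by
          by_contra h3
          have h3' : (u : R) - z * y ∈ IsLocalRing.maximalIdeal R := h3
          have := add_mem h3' hzm
          rw [sub_add_cancel] at this
          exact hx this
        exact hmin k (by omega) (h2.mul_left_eq_zero.1 h1)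
      · intro h
        rw [hz, Ideal.mem_span_singleton] at h
        obtain ⟨y, rfl⟩ := h
        rw [Ideal.mem_span_singleton]
        exact ⟨y, by ring⟩
    rw [← pow_succ, ← hr, ← AddSubgroup.index_comap, hc]
    rfl

end FVR

/-- **Corollary.** For a finite valuation ring `R` (order `q^r`) and any nonempty `A ⊆ R`
consisting of units with `A + 1` also consisting of units,
`|A⬝(A+1)|² ≥ (1/(8r)) * min (qʳ|A|) (|A|⁴/q^{2r-1})`. -/
theorem stmt_1 {R : Type*} [CommRing R] [Fintype R] [IsLocalRing R] [IsPrincipalIdealRing R]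
    (z : R) (hz : IsLocalRing.maximalIdeal R = Ideal.span {z})
    (r : ℕ) (hzr : z ^ r = 0) (hmin : ∀ k < r, z ^ k ≠ 0)
    (q : ℕ) (hq : Nat.card (IsLocalRing.ResidueField R) = q) (hqodd : Odd q)
    (A : Set R) (hA : A.Nonempty)
    (hAu : ∀ a ∈ A, IsUnit a) (hA1u : ∀ a ∈ A, IsUnit (a + 1)) :
    (Nat.card ↥((A * ((fun a => a + 1) '' A) : Set R)) : ℝ) ^ 2 ≥
      1 / (8 * (r : ℝ)) *
        min ((q : ℝ) ^ r * (Nat.card A : ℝ))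
          ((Nat.card A : ℝ) ^ 4 / (q : ℝ) ^ (2 * r - 1)) := by
  classical
  have hr0 : r ≠ 0 := by
    rintro rfl
    simp at hzr
  have hQ : Nat.card R = q ^ r := by
    have h := FVR.index_pow z hz r hmin r le_rfl
    rw [hzr, hq] at h
    rw [← h]
    simp
  have hM : q * Nat.card {x : R // ¬ IsUnit x} = Nat.card R := by
    have h := (IsLocalRing.maximalIdeal R).toAddSubgroup.index_mul_card
    rw [← h, ← hq]
    rfl
  have hqpos : 0 < q := hqodd.pos
  have hQR : (Fintype.card R : ℝ) = (q : ℝ) ^ r := by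
    rw [← Nat.card_eq_fintype_card, hQ]; push_cast; rfl
  have hq0 : (0 : ℝ) < q := by exact_mod_cast hqpos
  have hK : (Fintype.card R : ℝ) * Nat.card {x : R // ¬ IsUnit x} = (q : ℝ) ^ (2 * r - 1) := by
    have h1 : (q : ℝ) * Nat.card {x : R // ¬ IsUnit x} = (q : ℝ) ^ r := by
      rw [hQ] at hM; exact_mod_cast hM
    have h2 : (q : ℝ) * (q : ℝ) ^ (2 * r - 1) = (q : ℝ) ^ r * (q : ℝ) ^ r := by
      rw [← pow_succ', ← pow_add]; congr 1; omega
    apply mul_left_cancel₀ hq0.ne'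
    rw [h2, hQR]
    linear_combination (q : ℝ) ^ r * h1
  set P : Set R := A * ((fun a => a + 1) '' A) with hPdef
  have key := FVR.main A.toFinset P.toFinset (by simpa using hA)
    (fun a ha => hAu a (by simpa using ha)) (fun a ha => hA1u a (by simpa using ha))
    (fun a ha b hb => by
      rw [Set.mem_toFinset] at *
      exact Set.mul_mem_mul ha ⟨b, hb, rfl⟩)
    (fun p hp => by
      rw [Set.mem_toFinset] at hp
      obtain ⟨a, ha, _, ⟨b, hb, rfl⟩, rfl⟩ := hp
      exact (hAu a ha).mul (hA1u b hb)) _ (by positivity) hK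
  have e1 : Nat.card A = A.toFinset.card := by rw [Nat.card_eq_card_toFinset]
  have e2 : Nat.card P = P.toFinset.card := by rw [Nat.card_eq_card_toFinset]
  rw [e1, e2]
  rw [hQR] at key
  have hr1 : (1 : ℝ) ≤ r := by exact_mod_cast Nat.one_le_iff_ne_zero.2 hr0
  have hinv : 1 / (8 * (r : ℝ)) ≤ 1 / 4 := one_div_le_one_div_of_le (by norm_num) (by linarith)
  have hX : 0 ≤ (q : ℝ) ^ r * (A.toFinset.card : ℝ) := by positivity
  have hY : 0 ≤ (A.toFinset.card : ℝ) ^ 4 / (q : ℝ) ^ (2 * r - 1) := by positivity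
  have hmin0 := le_min hX hY
  refine le_trans (mul_le_mul_of_nonneg_right hinv hmin0) ?_
  rcases key with key | key
  · have := min_le_left ((q : ℝ) ^ r * (A.toFinset.card : ℝ))
      ((A.toFinset.card : ℝ) ^ 4 / (q : ℝ) ^ (2 * r - 1))
    linarith
  · have := min_le_right ((q : ℝ) ^ r * (A.toFinset.card : ℝ))
      ((A.toFinset.card : ℝ) ^ 4 / (q : ℝ) ^ (2 * r - 1))
    rw [mul_comm (4 : ℝ), ← div_div] at key
    linarith
end

section
/- Let R be a finite valuation ring with uniformizer z, nilpotency degree r, and residue field of odd cardinality q. Let g : R^* → R^* be a function, let m be a positive integer with μ(g) ≤ m and μ(x ↦ x·g(x)) ≤ m, and define f(x,y) = g(x)·(x+y) on R^* × R^*. Then for every nonempty set A ⊆ R^*, one has |f(A,A)| · min{ |A·A| , |A+A| } ≥ (1/(8r)) · min{ q^r·|A|/m , |A|^4 / (m^2·q^{2r-1}) }. -/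
open Pointwise

open Classical in
/-- number of points of `P` on the line `y = l.1 * x + l.2`. -/
noncomputable def incCount {R : Type*} [CommRing R] (P : Finset (R × R)) (l : R × R) : ℕ :=
  (P.filter (fun p => p.2 = l.1 * p.1 + l.2)).card

theorem card_span_pow {R : Type*} [CommRing R] [Fintype R] [IsLocalRing R]
    (z : R) (hz : IsLocalRing.maximalIdeal R = Ideal.span {z})
    (r : ℕ) (hzr : z ^ r = 0) (hmin : ∀ k < r, z ^ k ≠ 0)
    (q : ℕ) (hq : Nat.card (IsLocalRing.ResidueField R) = q) :
    ∀ j k : ℕ, j + k = r → Nat.card (Ideal.span {z ^ k} : Ideal R) = q ^ j := by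
  intro j
  induction j with
  | zero =>
    intro k hk
    obtain rfl : k = r := by omega
    rw [hzr, Ideal.span_singleton_eq_bot.mpr rfl]
    simp
  | succ j ih =>
    intro k hk
    have h1 := ih (k + 1) (by omega)
    -- the map `R → R / (z^(k+1))`, `x ↦ z^k x`
    let J : Ideal R := Ideal.span {z ^ (k + 1)}
    let I : Ideal R := Ideal.span {z ^ k}
    have hJI : J ≤ I := by
      rw [Ideal.span_singleton_le_span_singleton]
      exact pow_dvd_pow z (by omega)
    let φ : R →ₗ[R] R ⧸ J := J.mkQ.comp (LinearMap.mulLeft R (z ^ k))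
    have hker : LinearMap.ker φ = IsLocalRing.maximalIdeal R := by
      ext x
      rw [LinearMap.mem_ker]
      change J.mkQ (z ^ k * x) = 0 ↔ _
      rw [Submodule.mkQ_apply, Submodule.Quotient.mk_eq_zero]
      constructor
      · intro h
        by_contra hx
        have hu : IsUnit x := by
          by_contra h'
          exact hx ((IsLocalRing.mem_maximalIdeal x).2 h')
        obtain ⟨u, rfl⟩ := hu
        obtain ⟨y, hy⟩ := Ideal.mem_span_singleton'.1 h
        have hzm : z ∈ IsLocalRing.maximalIdeal R := by
          rw [hz]; exact Ideal.mem_span_singleton_self z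
        have hn : IsUnit (1 - z * (y * (↑u⁻¹ : R))) := by
          apply IsLocalRing.isUnit_one_sub_self_of_mem_nonunits
          exact (IsLocalRing.mem_maximalIdeal _).1 (Ideal.mul_mem_right _ _ hzm)
        apply hmin k (by omega)
        have h0 : z ^ k * (1 - z * (y * (↑u⁻¹ : R))) = 0 := by
          have : z ^ k = y * z ^ (k + 1) * (↑u⁻¹ : R) := by
            rw [hy, mul_assoc, Units.mul_inv, mul_one]
          linear_combination this
        exact (hn.mul_left_eq_zero).1 h0
      · intro h
        rw [hz] at h
        obtain ⟨y, rfl⟩ := Ideal.mem_span_singleton'.1 h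
        exact Ideal.mem_span_singleton'.2 ⟨y, by ring⟩
    have hrange : LinearMap.range φ = Submodule.map J.mkQ I := by
      rw [LinearMap.range_comp]
      congr 1
      ext x
      constructor
      · rintro ⟨y, rfl⟩
        exact Ideal.mem_span_singleton'.2 ⟨y, by simp [mul_comm]⟩
      · intro h
        obtain ⟨y, rfl⟩ := Ideal.mem_span_singleton'.1 h
        exact ⟨y, by simp [mul_comm]⟩
    have e1 : Nat.card (LinearMap.range φ) = q := by
      rw [← hq, ← Nat.card_congr φ.quotKerEquivRange.toEquiv, hker]
      rfl
    -- the restriction of `mkQ` to `I`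
    let ψ : I →ₗ[R] R ⧸ J := J.mkQ.comp I.subtype
    have hψr : LinearMap.range ψ = Submodule.map J.mkQ I := by
      rw [LinearMap.range_comp, Submodule.range_subtype]
    have hψk : Nat.card (LinearMap.ker ψ) = Nat.card J := by
      apply Nat.card_congr
      refine ⟨fun x => ⟨x.1.1, ?_⟩, fun x => ⟨⟨x.1, hJI x.2⟩, ?_⟩, fun x => rfl, fun x => rfl⟩
      · have := x.2
        rw [LinearMap.mem_ker] at this
        exact (Submodule.Quotient.mk_eq_zero _).1 this
      · rw [LinearMap.mem_ker]
        exact (Submodule.Quotient.mk_eq_zero _).2 x.2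
    have h2 := Submodule.card_eq_card_quotient_mul_card (LinearMap.ker ψ)
    rw [Nat.card_congr ψ.quotKerEquivRange.toEquiv, hψr, ← hrange, e1, hψk] at h2
    change Nat.card I = _
    rw [h2, h1]
    ring

open Classical in
theorem sum_inc_sq {R : Type*} [CommRing R] [Fintype R] [IsLocalRing R]
    (P : Finset (R × R)) :
    ∑ l : R × R, (incCount P l) ^ 2 ≤
      P.card ^ 2 + Nat.card R * Nat.card (IsLocalRing.maximalIdeal R) * P.card := by
  have h1 : ∀ l : R × R, (incCount P l) ^ 2 = ∑ p ∈ P, ∑ p' ∈ P,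
      if (p.2 = l.1 * p.1 + l.2 ∧ p'.2 = l.1 * p'.1 + l.2) then 1 else 0 := by
    intro l
    unfold incCount
    rw [Finset.card_filter, sq, Finset.sum_mul_sum]
    refine Finset.sum_congr rfl fun p _ => Finset.sum_congr rfl fun p' _ => ?_
    by_cases h : p.2 = l.1 * p.1 + l.2 <;> by_cases h' : p'.2 = l.1 * p'.1 + l.2 <;> simp [h, h']
  simp_rw [h1]
  rw [Finset.sum_comm]
  have h2 : ∀ p ∈ P, ∑ l : R × R, ∑ p' ∈ P,
      (if (p.2 = l.1 * p.1 + l.2 ∧ p'.2 = l.1 * p'.1 + l.2) then 1 else 0) ≤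
      P.card + Nat.card R * Nat.card (IsLocalRing.maximalIdeal R) := by
    intro p _
    let T : Finset ((R × R) × (R × R)) := (Finset.univ ×ˢ P).filter
      (fun t => p.2 = t.1.1 * p.1 + t.1.2 ∧ t.2.2 = t.1.1 * t.2.1 + t.1.2)
    have hT : ∑ l : R × R, ∑ p' ∈ P,
      (if (p.2 = l.1 * p.1 + l.2 ∧ p'.2 = l.1 * p'.1 + l.2) then 1 else 0) = T.card := by
      rw [Finset.card_filter, Finset.sum_product]
    rw [hT, ← Finset.card_filter_add_card_filter_not (s := T) (fun t => IsUnit (t.2.1 - p.1))]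
    apply add_le_add
    · apply Finset.card_le_card_of_injOn (fun t => t.2)
      · intro t ht
        simp [T] at ht
        exact ht.1.1
      · rintro ⟨⟨a, b⟩, x, y⟩ ht ⟨⟨a', b'⟩, x', y'⟩ ht' h
        simp [T] at ht ht' h
        obtain ⟨rfl, rfl⟩ := h
        obtain ⟨⟨_, h1, h2⟩, hu⟩ := ht
        obtain ⟨⟨_, h1', h2'⟩, _⟩ := ht'
        have : (x - p.1) * a = (x - p.1) * a' := by
          linear_combination (-h2) + h1 + h2' - h1'
        have ha : a = a' := hu.mul_left_cancel this
        subst ha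
        have : b = b' := by linear_combination h2' - h2
        subst this
        rfl
    · have hc : Nat.card R * Nat.card (IsLocalRing.maximalIdeal R) =
          ((Finset.univ : Finset R) ×ˢ
            (Finset.univ.filter (fun x : R => x ∈ IsLocalRing.maximalIdeal R))).card := by
        rw [Finset.card_product, Nat.card_eq_fintype_card, Finset.card_univ,
          Nat.card_eq_fintype_card, Fintype.card_subtype]
      rw [hc]
      apply Finset.card_le_card_of_injOn (fun t => (t.1.1, t.2.1 - p.1))
      · intro t ht
        simp [T] at ht
        simpa using ht.2
      · rintro ⟨⟨a, b⟩, x, y⟩ ht ⟨⟨a', b'⟩, x', y'⟩ ht' h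
        simp [T] at ht ht' h
        obtain ⟨rfl, rfl⟩ := h
        obtain ⟨⟨_, h1, h2⟩, hu⟩ := ht
        obtain ⟨⟨_, h1', h2'⟩, _⟩ := ht'
        have : b = b' := by linear_combination h1' - h1
        subst this
        rw [h2, h2']
  calc _ ≤ ∑ p ∈ P, (P.card + Nat.card R * Nat.card (IsLocalRing.maximalIdeal R)) :=
        Finset.sum_le_sum h2
    _ = _ := by rw [Finset.sum_const, smul_eq_mul]; ring

open Classical in
theorem sum_inc {R : Type*} [CommRing R] [Fintype R] (P : Finset (R × R)) :
    ∑ l : R × R, incCount P l = P.card * Nat.card R := by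
  unfold incCount
  simp_rw [Finset.card_filter]
  rw [Finset.sum_comm]
  have : ∀ p ∈ P, (∑ l : R × R, if p.2 = l.1 * p.1 + l.2 then 1 else 0) = Nat.card R := by
    intro p _
    rw [Fintype.sum_prod_type, Nat.card_eq_fintype_card, Fintype.card]
    rw [Finset.card_eq_sum_ones]
    refine Finset.sum_congr rfl fun u _ => ?_
    rw [Finset.sum_eq_single (p.2 - u * p.1)]
    · simp
    · intro b _ hb
      rw [if_neg]
      intro h
      exact hb (by linear_combination -h)
    · simp
  rw [Finset.sum_congr rfl this, Finset.sum_const, smul_eq_mul]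

theorem sum_inc_var {R : Type*} [CommRing R] [Fintype R] [IsLocalRing R]
    (P : Finset (R × R)) :
    ∑ l : R × R, ((incCount P l : ℝ) - P.card / (Nat.card R : ℝ)) ^ 2 ≤
      (Nat.card R : ℝ) * Nat.card (IsLocalRing.maximalIdeal R) * P.card := by
  have h1 : (∑ l : R × R, (incCount P l : ℝ) ^ 2) ≤
      (P.card : ℝ) ^ 2 + Nat.card R * Nat.card (IsLocalRing.maximalIdeal R) * P.card := by
    exact_mod_cast sum_inc_sq P
  have h2 : (∑ l : R × R, (incCount P l : ℝ)) = P.card * Nat.card R := by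
    exact_mod_cast sum_inc P
  have hN : (Nat.card R : ℝ) ≠ 0 := by
    have : Nat.card R ≠ 0 := Nat.card_ne_zero.2 ⟨⟨0⟩, inferInstance⟩
    exact_mod_cast this
  have h3 : ∑ l : R × R, ((incCount P l : ℝ) - P.card / (Nat.card R : ℝ)) ^ 2 =
      (∑ l : R × R, (incCount P l : ℝ) ^ 2)
        - 2 * (P.card / (Nat.card R : ℝ)) * (∑ l : R × R, (incCount P l : ℝ))
        + (Nat.card R : ℝ) ^ 2 * (P.card / (Nat.card R : ℝ)) ^ 2 := by
    simp_rw [sub_sq]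
    rw [Finset.sum_add_distrib, Finset.sum_sub_distrib, Finset.sum_const, Finset.card_univ,
      Fintype.card_prod, Finset.mul_sum, nsmul_eq_mul, ← Nat.card_eq_fintype_card]
    push_cast
    rw [← sq]
    congr 2
    exact Finset.sum_congr rfl fun l _ => by ring
  rw [h3, h2]
  have h4 : 2 * (P.card / (Nat.card R : ℝ)) * (P.card * Nat.card R : ℝ) = 2 * (P.card : ℝ) ^ 2 := by
    field_simp
  have h5 : (Nat.card R : ℝ) ^ 2 * (P.card / (Nat.card R : ℝ)) ^ 2 = (P.card : ℝ) ^ 2 := by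
    field_simp
  rw [h4, h5]
  linarith

open Classical in
/-- Main counting lemma. -/
theorem rich_lines {R : Type*} [CommRing R] [Fintype R] [IsLocalRing R]
    (P : Finset (R × R)) {ι : Type*} (J : Finset ι) (ℓ : ι → R × R) (m k : ℕ)
    (hJ : J.card = k ^ 2)
    (hm : ∀ l, (J.filter (fun i => ℓ i = l)).card ≤ m)
    (hk : ∀ i ∈ J, k ≤ incCount P (ℓ i)) :
    (Nat.card R : ℝ) * k / 2 ≤ P.card ∨
    (k : ℝ) ^ 4 ≤ 4 * m * ((Nat.card R : ℝ) * Nat.card (IsLocalRing.maximalIdeal R)) * P.card := by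
  by_cases h : (Nat.card R : ℝ) * k / 2 ≤ P.card
  · exact Or.inl h
  right
  push Not at h
  have hN : (0 : ℝ) < Nat.card R := by
    have : Nat.card R ≠ 0 := Nat.card_ne_zero.2 ⟨⟨0⟩, inferInstance⟩
    exact_mod_cast Nat.pos_of_ne_zero this
  have h1 : (P.card : ℝ) / Nat.card R ≤ k / 2 := by
    rw [div_le_iff₀ hN]; linarith
  have hcard : J.card ≤ m * (J.image ℓ).card :=
    Finset.card_le_mul_card_image J m (fun l _ => hm l)
  have h2 : ∑ l ∈ J.image ℓ, ((k : ℝ) ^ 2 / 4) ≤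
      (Nat.card R : ℝ) * Nat.card (IsLocalRing.maximalIdeal R) * P.card := by
    refine le_trans ?_ (sum_inc_var P)
    refine le_trans (Finset.sum_le_sum (g := fun l => ((incCount P l : ℝ) - P.card / (Nat.card R : ℝ)) ^ 2) ?_)
      (Finset.sum_le_sum_of_subset_of_nonneg (Finset.subset_univ _) (fun l _ _ => sq_nonneg _))
    intro l hl
    obtain ⟨i, hi, rfl⟩ := Finset.mem_image.1 hl
    have h3 : (k : ℝ) ≤ incCount P (ℓ i) := by exact_mod_cast hk i hi
    have h0 : (0 : ℝ) ≤ k := Nat.cast_nonneg k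
    have h4 : (k : ℝ) / 2 ≤ (incCount P (ℓ i) : ℝ) - P.card / (Nat.card R : ℝ) := by linarith
    calc (k : ℝ) ^ 2 / 4 = ((k : ℝ) / 2) ^ 2 := by ring
      _ ≤ _ := by gcongr
  rw [Finset.sum_const, nsmul_eq_mul] at h2
  have h5 : (k : ℝ) ^ 2 ≤ m * (J.image ℓ).card := by
    rw [hJ] at hcard; exact_mod_cast hcard
  calc (k : ℝ) ^ 4 = k ^ 2 * k ^ 2 := by ring
    _ ≤ ((m : ℝ) * ((J.image ℓ).card : ℝ)) * (k : ℝ) ^ 2 := by gcongr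
    _ = 4 * (m : ℝ) * (((J.image ℓ).card : ℝ) * ((k : ℝ) ^ 2 / 4)) := by ring
    _ ≤ 4 * m * ((Nat.card R : ℝ) * Nat.card (IsLocalRing.maximalIdeal R) * P.card) := by gcongr
    _ = _ := by ring

/-- **Corollary.**  Let `R` be a finite valuation ring with uniformizer `z`, nilpotency
degree `r`, residue field of odd cardinality `q`, `g : Rˣ → Rˣ` with `μ(g) ≤ m` and
`μ(x ↦ x * g x) ≤ m`, and `f (x, y) = g x * (x + y)`.  For every nonempty `A ⊆ Rˣ`,
`|f(A,A)| * min |A⬝A| |A+A| ≥ (1/(8r)) * min (qʳ|A|/m) (|A|⁴/(m² q^{2r-1}))`. -/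
theorem stmt_3 {R : Type*} [CommRing R] [Fintype R] [IsLocalRing R] [IsPrincipalIdealRing R]
    (z : R) (hz : IsLocalRing.maximalIdeal R = Ideal.span {z})
    (r : ℕ) (hzr : z ^ r = 0) (hmin : ∀ k < r, z ^ k ≠ 0)
    (q : ℕ) (hq : Nat.card (IsLocalRing.ResidueField R) = q) (hqodd : Odd q)
    (g : Rˣ → Rˣ) (m : ℕ) (hmpos : 0 < m)
    (hg : ∀ t : Rˣ, Nat.card {x : Rˣ // g x = t} ≤ m)
    (hxg : ∀ t : Rˣ, Nat.card {x : Rˣ // x * g x = t} ≤ m)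
    (A : Set Rˣ) (hA : A.Nonempty) :
    (Nat.card (Set.image2 (fun (x y : Rˣ) => (g x : R) * ((x : R) + (y : R))) A A) : ℝ)
        * min (Nat.card ↥((A * A : Set Rˣ)) : ℝ)
            (Nat.card (Set.image2 (fun (x y : Rˣ) => (x : R) + (y : R)) A A) : ℝ) ≥
      1 / (8 * (r : ℝ)) *
        min ((q : ℝ) ^ r * (Nat.card A : ℝ) / (m : ℝ))
          ((Nat.card A : ℝ) ^ 4 / ((m : ℝ) ^ 2 * (q : ℝ) ^ (2 * r - 1))) := by
  classical
  have hr : 1 ≤ r := by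
    rcases Nat.eq_zero_or_pos r with h | h
    · subst h; simp at hzr
    · exact h
  have hN : Nat.card R = q ^ r := by
    have := card_span_pow z hz r hzr hmin q hq r 0 (by omega)
    rw [← this, pow_zero, Ideal.span_singleton_one]
    exact (Nat.card_congr (Equiv.Set.univ R)).symm
  have hM : Nat.card (IsLocalRing.maximalIdeal R) = q ^ (r - 1) := by
    have := card_span_pow z hz r hzr hmin q hq (r - 1) 1 (by omega)
    rw [← this, pow_one, hz]
  have hNM : (Nat.card R : ℝ) * Nat.card (IsLocalRing.maximalIdeal R) = (q : ℝ) ^ (2 * r - 1) := by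
    rw [hN, hM]; push_cast; rw [← pow_add]; congr 1; omega
  have hqpos : (0 : ℝ) < q := by
    have := hqodd.pos; exact_mod_cast this
  -- finset versions
  let B : Finset Rˣ := A.toFinset
  have hB : ∀ x, x ∈ B ↔ x ∈ A := fun x => Set.mem_toFinset
  have hBc : Nat.card A = B.card := by
    rw [Nat.card_eq_fintype_card, Set.toFinset_card]
  have hkpos : 1 ≤ B.card := by
    obtain ⟨a, ha⟩ := hA
    exact Finset.card_pos.2 ⟨a, (hB a).2 ha⟩
  let F : Finset R := (Set.image2 (fun (x y : Rˣ) => (g x : R) * ((x : R) + (y : R))) A A).toFinset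
  have hF : ∀ x ∈ A, ∀ y ∈ A, (g x : R) * ((x : R) + (y : R)) ∈ F := fun x hx y hy =>
    Set.mem_toFinset.2 ⟨x, hx, y, hy, rfl⟩
  have hFc : Nat.card (Set.image2 (fun (x y : Rˣ) => (g x : R) * ((x : R) + (y : R))) A A)
      = F.card := by
    rw [Nat.card_eq_fintype_card, Set.toFinset_card]
  -- numeric conclusion
  have key : ∀ (S : Finset R) (ℓ : Rˣ × Rˣ → R × R),
      (∀ l, ((B ×ˢ B).filter (fun i => ℓ i = l)).card ≤ m) →
      (∀ i ∈ B ×ˢ B, B.card ≤ incCount (S ×ˢ F) (ℓ i)) →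
      1 / (8 * (r : ℝ)) *
        min ((q : ℝ) ^ r * (B.card : ℝ) / (m : ℝ))
          ((B.card : ℝ) ^ 4 / ((m : ℝ) ^ 2 * (q : ℝ) ^ (2 * r - 1))) ≤ (F.card : ℝ) * S.card := by
    intro S ℓ h1 h2
    have hr' : (1 : ℝ) ≤ r := by exact_mod_cast hr
    have hm' : (1 : ℝ) ≤ m := by exact_mod_cast hmpos
    have hPc : (((S ×ˢ F).card : ℕ) : ℝ) = (F.card : ℝ) * S.card := by
      rw [Finset.card_product]; push_cast; ring
    have h8 : 0 ≤ 1 / (8 * (r : ℝ)) := by positivity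
    rcases rich_lines (S ×ˢ F) (B ×ˢ B) ℓ m B.card (by rw [Finset.card_product, sq]) h1 h2 with h | h
    · rw [hPc, hN] at h
      push_cast at h
      refine le_trans ?_ h
      refine le_trans (mul_le_mul_of_nonneg_left (min_le_left _ _) h8) ?_
      have : (1 / (8 * (r : ℝ))) ≤ 1 / 2 := by
        apply one_div_le_one_div_of_le <;> linarith
      have h3 : (q : ℝ) ^ r * (B.card : ℝ) / (m : ℝ) ≤ (q : ℝ) ^ r * (B.card : ℝ) :=
        div_le_self (by positivity) hm'
      calc _ ≤ 1 / 2 * ((q : ℝ) ^ r * (B.card : ℝ)) := by gcongr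
        _ = _ := by ring
    · rw [hPc, hNM] at h
      refine le_trans (mul_le_mul_of_nonneg_left (min_le_right _ _) h8) ?_
      rw [div_mul_div_comm, one_mul, div_le_iff₀ (by positivity)]
      refine h.trans ?_
      have h9 : 4 * (m : ℝ) ≤ 8 * r * m ^ 2 := by nlinarith
      calc _ ≤ 8 * r * (m : ℝ) ^ 2 * (q : ℝ) ^ (2 * r - 1) * ((F.card : ℝ) * S.card) := by gcongr
        _ = _ := by ring
  rw [ge_iff_le, hBc, hFc]
  rcases le_total (Nat.card ↥((A * A : Set Rˣ)) : ℝ)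
    (Nat.card (Set.image2 (fun (x y : Rˣ) => (x : R) + (y : R)) A A) : ℝ) with h | h
  · rw [min_eq_left h]
    -- product case
    let S : Finset R := (A * A).toFinset.image (fun u : Rˣ => (u : R))
    have hS : Nat.card ↥((A * A : Set Rˣ)) = S.card := by
      rw [Finset.card_image_of_injective _ Units.val_injective, Nat.card_eq_fintype_card,
        Set.toFinset_card]
    rw [hS]
    refine key S (fun i => ((g i.1 * i.2⁻¹ : Rˣ), (i.1 * g i.1 : Rˣ))) ?_ ?_
    · rintro ⟨l1, l2⟩
      by_cases hl : ∃ t : Rˣ, (t : R) = l2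
      · obtain ⟨t, rfl⟩ := hl
        refine le_trans ?_ (hxg t)
        rw [Nat.card_eq_fintype_card, Fintype.card_subtype]
        apply Finset.card_le_card_of_injOn (fun i => i.1)
        · rintro ⟨a, c⟩ hi
          simp only [Finset.coe_filter, Set.mem_ofPred_eq, Prod.mk.injEq] at hi
          simpa using Units.ext hi.2.2
        · rintro ⟨a, c⟩ hi ⟨a', c'⟩ hi' (rfl : a = a')
          simp only [Finset.coe_filter, Set.mem_ofPred_eq, Prod.mk.injEq] at hi hi'
          have := Units.ext (hi.2.1.trans hi'.2.1.symm)
          have := inv_injective (mul_left_cancel this)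
          rw [this]
      · rw [Finset.card_eq_zero.2]
        · omega
        · apply Finset.filter_eq_empty_iff.2
          intro i _ hi
          exact hl ⟨i.1 * g i.1, congrArg Prod.snd hi⟩
    · rintro ⟨a, c⟩ hi
      rw [Finset.mem_product, hB, hB] at hi
      apply Finset.card_le_card_of_injOn
        (fun b : Rˣ => (((b * c : Rˣ) : R), (g a : R) * ((a : R) + (b : R))))
      · intro b hb
        have hb := (hB b).1 hb
        simp only [Finset.coe_filter, Finset.mem_product, Set.mem_ofPred_eq]
        refine ⟨⟨Finset.mem_image.2 ⟨b * c, Set.mem_toFinset.2 (Set.mul_mem_mul hb hi.2), rfl⟩,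
          hF a hi.1 b hb⟩, ?_⟩
        push_cast
        have : (c : R) * (↑c⁻¹ : R) = 1 := Units.mul_inv c
        linear_combination -(g a : R) * b * this
      · intro b _ b' _ hbb
        have : b * c = b' * c := Units.ext (congrArg Prod.fst hbb)
        exact mul_right_cancel this
  · rw [min_eq_right h]
    let S : Finset R := (Set.image2 (fun (x y : Rˣ) => (x : R) + (y : R)) A A).toFinset
    have hS : Nat.card (Set.image2 (fun (x y : Rˣ) => (x : R) + (y : R)) A A) = S.card := by
      rw [Nat.card_eq_fintype_card, Set.toFinset_card]
    rw [hS]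
    refine key S (fun i => ((g i.1 : R), (g i.1 : R) * ((i.1 : R) - i.2))) ?_ ?_
    · rintro ⟨l1, l2⟩
      by_cases hl : ∃ t : Rˣ, (t : R) = l1
      · obtain ⟨t, rfl⟩ := hl
        refine le_trans ?_ (hg t)
        rw [Nat.card_eq_fintype_card, Fintype.card_subtype]
        apply Finset.card_le_card_of_injOn (fun i => i.1)
        · rintro ⟨a, c⟩ hi
          simp only [Finset.coe_filter, Set.mem_ofPred_eq, Prod.mk.injEq] at hi
          simpa using Units.ext hi.2.1
        · rintro ⟨a, c⟩ hi ⟨a', c'⟩ hi' (rfl : a = a')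
          simp only [Finset.coe_filter, Set.mem_ofPred_eq, Prod.mk.injEq] at hi hi'
          have := (g a).isUnit.mul_left_cancel (hi.2.2.trans hi'.2.2.symm)
          have : c = c' := Units.ext (by linear_combination -this)
          rw [this]
      · rw [Finset.card_eq_zero.2]
        · omega
        · apply Finset.filter_eq_empty_iff.2
          intro i _ hi
          exact hl ⟨g i.1, congrArg Prod.fst hi⟩
    · rintro ⟨a, c⟩ hi
      rw [Finset.mem_product, hB, hB] at hi
      apply Finset.card_le_card_of_injOn
        (fun b : Rˣ => ((b : R) + (c : R), (g a : R) * ((a : R) + (b : R))))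
      · intro b hb
        have hb := (hB b).1 hb
        simp only [Finset.coe_filter, Finset.mem_product, Set.mem_ofPred_eq]
        refine ⟨⟨Set.mem_toFinset.2 ⟨b, hb, c, hi.2, rfl⟩, hF a hi.1 b hb⟩, ?_⟩
        ring
      · intro b _ b' _ hbb
        exact Units.ext (add_right_cancel (congrArg Prod.fst hbb))
end

section
/- Let R be a finite valuation ring with uniformizer z, nilpotency degree r, and residue field of odd cardinality q. Let g : R^* → R^* be a function and let m be a positive integer with μ(x ↦ g(x)^2·x) ≤ m, and define f(x,y) = x·y·(g(x)+y) on R^* × R^*. Then for all nonempty sets A, B, C ⊆ R^*, one has |f(A,B)| · |B·C| ≥ (1/(8r)) · min{ q^r·|B|/m , |A|·|B|^2·|C| / (m^2·q^{2r-1}) }. -/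
open Pointwise

section helpers
open Finset Classical

lemma aux_card_s5 {R : Type*} [CommRing R] [Fintype R] (t : R) (H : AddSubgroup R)
    (hH : (AddMonoidHom.mulLeft t).ker ≤ H) :
    Nat.card (H.map (AddMonoidHom.mulLeft t)) * Nat.card (AddMonoidHom.mulLeft t).ker
      = Nat.card H := by
  have h := AddSubgroup.card_mul_index ((AddMonoidHom.mulLeft t).comp H.subtype).ker
  rw [AddSubgroup.index_ker] at h
  have h1 : ((AddMonoidHom.mulLeft t).comp H.subtype).range = H.map (AddMonoidHom.mulLeft t) := by
    rw [AddMonoidHom.range_comp, AddSubgroup.range_subtype]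
  have h2 : Nat.card ((AddMonoidHom.mulLeft t).comp H.subtype).ker
      = Nat.card (AddMonoidHom.mulLeft t).ker := by
    apply Nat.card_congr
    exact
      { toFun := fun x => ⟨x.1.1, x.2⟩
        invFun := fun x => ⟨⟨x.1, hH x.2⟩, x.2⟩
        left_inv := fun x => rfl
        right_inv := fun x => rfl }
  rw [h1, h2] at h
  rw [← h, mul_comm]

noncomputable def nk {R : Type*} [CommRing R] [Fintype R] (t : R) : ℕ :=
  (univ.filter fun u : R => t * u = 0).card

noncomputable def Mk {R : Type*} [CommRing R] [Fintype R] (t : R) : ℕ :=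
  (univ.filter fun u : R => t ∣ u).card

lemma nk_eq {R : Type*} [CommRing R] [Fintype R] (t : R) :
    nk t = Nat.card (AddMonoidHom.mulLeft t).ker := by
  unfold nk
  rw [← Nat.subtype_card (univ.filter fun u : R => t * u = 0) (p := fun u => t * u = 0) (by simp)]
  rfl

lemma Mk_eq {R : Type*} [CommRing R] [Fintype R] (t : R) (s : AddSubgroup R)
    (hs : ∀ x, x ∈ s ↔ t ∣ x) : Mk t = Nat.card s := by
  unfold Mk
  rw [← Nat.subtype_card (univ.filter fun u : R => t ∣ u) (p := fun u => u ∈ s) (by simp [hs])]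

lemma nk_mul_Mk {R : Type*} [CommRing R] [Fintype R] (t : R) :
    nk t * Mk t = Fintype.card R := by
  have h := aux_card_s5 t ⊤ le_top
  rw [nk_eq, Mk_eq t (AddSubgroup.map (AddMonoidHom.mulLeft t) ⊤), mul_comm, h]
  · simp
  · intro x
    simp [AddSubgroup.mem_map, dvd_def, eq_comm]

lemma unit_of_not_dvd {R : Type*} [CommRing R] [IsLocalRing R]
    (z : R) (hz : IsLocalRing.maximalIdeal R = Ideal.span {z}) (x : R) (h : ¬ z ∣ x) :
    IsUnit x := by
  by_contra hx
  have : x ∈ IsLocalRing.maximalIdeal R := hx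
  rw [hz, Ideal.mem_span_singleton] at this
  exact h this

lemma not_unit_z {R : Type*} [CommRing R] [IsLocalRing R]
    (z : R) (hz : IsLocalRing.maximalIdeal R = Ideal.span {z}) (x : R) (h : z ∣ x) :
    ¬ IsUnit x := by
  have : x ∈ IsLocalRing.maximalIdeal R := by
    rwa [hz, Ideal.mem_span_singleton]
  exact this

lemma Mk_z {R : Type*} [CommRing R] [Fintype R] [IsLocalRing R]
    (z : R) (hz : IsLocalRing.maximalIdeal R = Ideal.span {z}) :
    Mk z * Nat.card (IsLocalRing.ResidueField R) = Fintype.card R := by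
  rw [Mk_eq z (IsLocalRing.maximalIdeal R).toAddSubgroup]
  · have := AddSubgroup.card_mul_index (IsLocalRing.maximalIdeal R).toAddSubgroup
    rw [Nat.card_eq_fintype_card (α := R)] at this
    rw [← this]
    rfl
  · intro x
    rw [hz]
    simp [Ideal.mem_span_singleton]

lemma Mk_succ {R : Type*} [CommRing R] [Fintype R] [IsLocalRing R]
    (z : R) (hz : IsLocalRing.maximalIdeal R = Ideal.span {z}) (k : ℕ) (hk : z ^ k ≠ 0) :
    Mk (z ^ k) = Mk (z ^ (k + 1)) * Nat.card (IsLocalRing.ResidueField R) := by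
  have hM : Mk z = Nat.card (IsLocalRing.maximalIdeal R).toAddSubgroup := by
    apply Mk_eq
    intro x
    rw [hz]
    simp [Ideal.mem_span_singleton]
  have h := aux_card_s5 (z ^ k) (IsLocalRing.maximalIdeal R).toAddSubgroup (by
    intro x hx
    have hx' : z ^ k * x = 0 := hx
    show ¬ IsUnit x
    intro hu
    exact hk ((hu.mul_left_eq_zero).1 hx'))
  rw [← hM, ← nk_eq, ← Mk_eq (z ^ (k+1))] at h
  · have h1 := nk_mul_Mk (z ^ k)
    have h2 := Mk_z z hz
    have hn : 0 < nk (z ^ k) := by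
      apply Nat.pos_of_ne_zero
      intro h0
      rw [h0, zero_mul] at h1
      exact Fintype.card_ne_zero h1.symm
    apply Nat.eq_of_mul_eq_mul_left hn
    rw [h1, ← h2, ← h]
    ring
  · intro x
    rw [hz]
    simp only [AddSubgroup.mem_map, Submodule.mem_toAddSubgroup, Ideal.mem_span_singleton]
    constructor
    · rintro ⟨y, ⟨w, rfl⟩, rfl⟩
      exact ⟨w, by simp [pow_succ, mul_assoc]⟩
    · rintro ⟨w, rfl⟩
      exact ⟨z * w, ⟨w, rfl⟩, by simp [pow_succ, mul_assoc]⟩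

lemma card_R {R : Type*} [CommRing R] [Fintype R] [IsLocalRing R]
    (z : R) (hz : IsLocalRing.maximalIdeal R = Ideal.span {z})
    (r : ℕ) (hzr : z ^ r = 0) (hmin : ∀ k < r, z ^ k ≠ 0) :
    Fintype.card R = Nat.card (IsLocalRing.ResidueField R) ^ r := by
  have h : ∀ k ≤ r, Fintype.card R = Mk (z ^ k) * Nat.card (IsLocalRing.ResidueField R) ^ k := by
    intro k
    induction k with
    | zero => intro _; simp [Mk]
    | succ k ih =>
      intro hk
      rw [ih (by omega), Mk_succ z hz k (hmin k (by omega))]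
      ring
  rw [h r le_rfl, hzr]
  have h0 : Mk (0 : R) = 1 := by
    unfold Mk
    rw [card_eq_one]
    exact ⟨0, by ext x; simp⟩
  rw [h0, one_mul]

lemma val_exists {R : Type*} [CommRing R] [IsLocalRing R]
    (z : R) (hz : IsLocalRing.maximalIdeal R = Ideal.span {z})
    (r : ℕ) (hzr : z ^ r = 0) (d : R) : ∃ k ≤ r, ∃ u : R, IsUnit u ∧ d = z ^ k * u := by
  have h : ∀ n ≤ r, z ^ n ∣ d ∨ ∃ k ≤ r, ∃ u : R, IsUnit u ∧ d = z ^ k * u := by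
    intro n
    induction n with
    | zero => intro _; left; simp
    | succ n ih =>
      intro hn
      rcases ih (by omega) with ⟨e, he⟩ | h
      · by_cases hze : z ∣ e
        · left
          rw [he, pow_succ]
          exact mul_dvd_mul_left _ hze
        · right
          exact ⟨n, by omega, e, unit_of_not_dvd z hz e hze, he⟩
      · exact Or.inr h
  rcases h r le_rfl with h | h
  · refine ⟨r, le_rfl, 1, isUnit_one, ?_⟩
    rw [hzr] at h ⊢
    simpa using h
  · exact h

lemma T_bound {R : Type*} [CommRing R] [Fintype R] [IsLocalRing R]
    (z : R) (hz : IsLocalRing.maximalIdeal R = Ideal.span {z})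
    (r : ℕ) (hzr : z ^ r = 0) (d c : R) :
    (univ.filter fun u : R => d * u = c).card ≤
      1 + ∑ k ∈ Icc 1 r, nk (z ^ k) * (if z ^ k ∣ d ∧ z ^ k ∣ c then 1 else 0) := by
  obtain ⟨k, hk, ε, hε, rfl⟩ := val_exists z hz r hzr d
  rcases (univ.filter fun u : R => z ^ k * ε * u = c).eq_empty_or_nonempty with h | ⟨u0, h0⟩
  · rw [h]; simp
  · simp only [mem_filter, mem_univ, true_and] at h0
    have hle : (univ.filter fun u : R => z ^ k * ε * u = c).card ≤ nk (z ^ k) := by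
      unfold nk
      apply card_le_card_of_injOn (fun u => u - u0)
      · intro u hu
        simp only [coe_filter, mem_univ, true_and, Set.mem_ofPred_eq] at hu ⊢
        apply (hε.mul_right_eq_zero).1
        linear_combination hu - h0
      · intro u _ v _ huv
        simpa using huv
    rcases Nat.eq_zero_or_pos k with rfl | hkp
    · refine hle.trans ?_
      have : nk ((z : R) ^ 0) = 1 := by
        unfold nk
        rw [card_eq_one]
        exact ⟨0, by ext x; simp⟩
      omega
    · have := single_le_sum (f := fun j => nk (z ^ j) *
        (if z ^ j ∣ z ^ k * ε ∧ z ^ j ∣ c then 1 else 0)) (s := Icc 1 r)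
        (fun _ _ => Nat.zero_le _) (mem_Icc.2 ⟨hkp, hk⟩)
      have hc : z ^ k ∣ c := ⟨ε * u0, by rw [← h0]; ring⟩
      simp only [dvd_mul_right, hc, and_self, if_true, mul_one] at this
      omega

lemma Mk_le {R : Type*} [CommRing R] [Fintype R] (z : R) (k : ℕ) (hk : 1 ≤ k) :
    Mk (z ^ k) ≤ Mk z := by
  unfold Mk
  apply card_le_card
  intro x hx
  simp only [mem_filter, mem_univ, true_and] at hx ⊢
  exact (dvd_pow_self z (by omega)).trans hx

lemma row_bound {R ι : Type*} [CommRing R] [Fintype R] [IsLocalRing R]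
    (z : R) (hz : IsLocalRing.maximalIdeal R = Ideal.span {z})
    (r : ℕ) (hzr : z ^ r = 0) (L : Finset ι) (a b : ι → R) (m : ℕ)
    (hm : ∀ α β, (L.filter fun i => a i = α ∧ b i = β).card ≤ m) (i : ι) :
    ∑ j ∈ L, (univ.filter fun u : R => (b i - b j) * u = a j - a i).card ≤
      L.card + m * (r * (Fintype.card R * Mk z)) := by
  calc _ ≤ ∑ j ∈ L, (1 + ∑ k ∈ Icc 1 r, nk (z ^ k) *
        (if z ^ k ∣ b i - b j ∧ z ^ k ∣ a j - a i then 1 else 0)) :=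
        sum_le_sum fun j _ => T_bound z hz r hzr _ _
    _ = L.card + ∑ k ∈ Icc 1 r, nk (z ^ k) *
        (L.filter fun j => z ^ k ∣ b i - b j ∧ z ^ k ∣ a j - a i).card := by
        rw [sum_add_distrib, sum_comm]
        congr 1
        · simp
        · refine sum_congr rfl fun k _ => ?_
          rw [← mul_sum, card_filter]
    _ ≤ L.card + ∑ k ∈ Icc 1 r, m * (Fintype.card R * Mk z) := by
        refine Nat.add_le_add_left (sum_le_sum fun k hk => ?_) _
        have h1 : (L.filter fun j => z ^ k ∣ b i - b j ∧ z ^ k ∣ a j - a i).card ≤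
            m * (Mk (z ^ k) * Mk (z ^ k)) := by
          unfold Mk
          rw [← card_product]
          apply card_le_mul_card_image_of_maps_to (f := fun j => (b i - b j, a j - a i))
          · intro j hj
            simpa using (mem_filter.1 hj).2
          · rintro ⟨β, α⟩ _
            refine le_trans (card_le_card ?_) (hm (α + a i) (b i - β))
            intro j hj
            simp only [mem_filter, Prod.mk.injEq] at hj ⊢
            refine ⟨hj.1.1, ?_, ?_⟩
            · rw [← hj.2.2]; ring
            · rw [← hj.2.1]; ring
        calc _ ≤ nk (z ^ k) * (m * (Mk (z ^ k) * Mk (z ^ k))) := by gcongr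
          _ = m * ((nk (z ^ k) * Mk (z ^ k)) * Mk (z ^ k)) := by ring
          _ ≤ m * (Fintype.card R * Mk z) := by
            rw [nk_mul_Mk]
            gcongr
            exact Mk_le z k (mem_Icc.1 hk).1
    _ = _ := by simp; ring

lemma incidence {R ι : Type*} [CommRing R] [Fintype R] [IsLocalRing R]
    (z : R) (hz : IsLocalRing.maximalIdeal R = Ideal.span {z})
    (r : ℕ) (hzr : z ^ r = 0) (L : Finset ι) (a b : ι → R) (m : ℕ)
    (hm : ∀ α β, (L.filter fun i => a i = α ∧ b i = β).card ≤ m) (E : Finset (R × R)) :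
    ((∑ e ∈ E, ((L.filter fun i => e.2 = a i + b i * e.1).card : ℝ))
      - E.card * L.card / Fintype.card R) ^ 2 ≤
      E.card * (L.card * (m * (r * (Fintype.card R * Mk z)))) := by
  set n : R × R → ℝ := fun e => ((L.filter fun i => e.2 = a i + b i * e.1).card : ℝ) with hn
  set N : ℝ := (Fintype.card R : ℝ) with hN
  have hN0 : N ≠ 0 := by simp [hN]
  set W : ℝ := (L.card : ℝ) with hW
  have hn' : ∀ e, n e = ∑ i ∈ L, if e.2 = a i + b i * e.1 then (1:ℝ) else 0 := by
    intro e; simp [hn]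
  have s1 : ∑ e, n e = N * W := by
    simp_rw [hn']
    rw [sum_comm]
    simp_rw [Fintype.sum_prod_type]
    simp [hN, hW, mul_comm]
  have s2 : ∑ e, n e ^ 2 ≤ W * (W + m * (r * (N * Mk z))) := by
    have : ∑ e, n e ^ 2 = ∑ i ∈ L, ∑ j ∈ L,
        ((univ.filter fun u : R => (b i - b j) * u = a j - a i).card : ℝ) := by
      simp_rw [hn', sq, sum_mul_sum]
      rw [sum_comm]
      refine sum_congr rfl fun i _ => ?_
      rw [sum_comm]
      refine sum_congr rfl fun j _ => ?_
      rw [Fintype.sum_prod_type, Finset.card_filter]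
      push_cast
      refine sum_congr rfl fun u _ => ?_
      simp only [mul_ite, mul_one, mul_zero, ← ite_and]
      have hiff : ((b i - b j) * u = a j - a i) ↔ a j + b j * u = a i + b i * u := by
        constructor <;> intro h <;> linear_combination (-h)
      by_cases h : a j + b j * u = a i + b i * u
      · simp [hiff, h]
      · rw [if_neg (by rwa [hiff])]
        apply sum_eq_zero
        intro v _
        rw [if_neg]
        rintro ⟨h1, h2⟩
        first | exact h (h1.symm.trans h2) | exact h (h2.symm.trans h1)
    rw [this]
    calc _ ≤ ∑ i ∈ L, (W + m * (r * (N * Mk z))) := by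
          refine sum_le_sum fun i _ => ?_
          have := row_bound z hz r hzr L a b m hm i
          rw [hN, hW]
          exact_mod_cast this
      _ = _ := by rw [sum_const, nsmul_eq_mul]
  have e1 : (∑ e ∈ E, n e) - E.card * W / N = ∑ e ∈ E, (n e - W / N) := by
    rw [sum_sub_distrib, sum_const, nsmul_eq_mul]; ring
  rw [e1]
  calc _ ≤ (E.card : ℝ) * ∑ e ∈ E, (n e - W / N) ^ 2 := sq_sum_le_card_mul_sum_sq
    _ ≤ E.card * ∑ e, (n e - W / N) ^ 2 := by
      refine mul_le_mul_of_nonneg_left ?_ (Nat.cast_nonneg _)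
      exact sum_le_sum_of_subset_of_nonneg (subset_univ _) (fun _ _ _ => sq_nonneg _)
    _ ≤ _ := by
      gcongr
      have : ∑ e, (n e - W / N) ^ 2 = ∑ e, n e ^ 2 - W ^ 2 := by
        have : ∀ e, (n e - W / N) ^ 2 = n e ^ 2 - 2 * (W / N) * n e + (W / N) ^ 2 := by
          intro e; ring
        simp_rw [this]
        rw [sum_add_distrib, sum_sub_distrib, ← mul_sum, s1]
        simp only [sum_const, card_univ, Fintype.card_prod, nsmul_eq_mul, Nat.cast_mul]
        rw [← hN]
        field_simp
        ring
      rw [this]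
      linarith

lemma final_arith (e l b N m r D I : ℝ) (he : 0 ≤ e) (hl : 0 < l) (hb : 0 < b) (hN : 0 < N)
    (hm : 1 ≤ m) (hr : 1 ≤ r) (hD : 0 < D) (hI : l * b ≤ I)
    (h : (I - e * l / N) ^ 2 ≤ e * (l * (m * (r * D)))) :
    1 / (8 * r) * min (N * b / m) (l * b ^ 2 / (m ^ 2 * D)) ≤ e := by
  have hm0 : 0 < m := by linarith
  have hr0 : 0 < r := by linarith
  by_cases hc : e * l / N ≤ I / 2
  · have h1 : l * b / 2 ≤ I - e * l / N := by linarith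
    have h2 : (l * b / 2) ^ 2 ≤ e * (l * (m * (r * D))) :=
      le_trans (pow_le_pow_left₀ (by positivity) h1 2) h
    have h3 : l * b ^ 2 ≤ 4 * e * (m * (r * D)) := by
      have : l * (l * b ^ 2) ≤ l * (4 * e * (m * (r * D))) := by nlinarith
      exact le_of_mul_le_mul_left this hl
    calc _ ≤ 1 / (8 * r) * (l * b ^ 2 / (m ^ 2 * D)) := by
          gcongr; exact min_le_right _ _
      _ = l * b ^ 2 / (8 * r * (m ^ 2 * D)) := by field_simp
      _ ≤ e := by
        rw [div_le_iff₀ (by positivity)]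
        refine h3.trans ?_
        have : m ≤ m ^ 2 := by nlinarith
        calc 4 * e * (m * (r * D)) = 4 * (e * (r * D)) * m := by ring
          _ ≤ 8 * (e * (r * D)) * m ^ 2 := by gcongr; norm_num
          _ = _ := by ring
  · push Not at hc
    have h1 : l * b / 2 ≤ e * l / N := by linarith
    have h2 : N * b ≤ 2 * e := by
      rw [le_div_iff₀ hN] at h1
      have : l * (N * b) ≤ l * (2 * e) := by nlinarith
      exact le_of_mul_le_mul_left this hl
    calc _ ≤ 1 / (8 * r) * (N * b / m) := by
          gcongr; exact min_le_left _ _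
      _ = N * b / (8 * r * m) := by field_simp
      _ ≤ e := by
        rw [div_le_iff₀ (by positivity)]
        have : 1 ≤ r * m := by nlinarith
        nlinarith

end helpers

/-- **Theorem 1.13.**  Let `R` be a finite valuation ring with uniformizer `z`, nilpotency
degree `r`, residue field of odd cardinality `q`, `g : Rˣ → Rˣ` with `μ(x ↦ g x ^ 2 * x) ≤ m`,
and `f (x, y) = x * y * (g x + y)`.  For all nonempty `A, B, C ⊆ Rˣ`,
`|f(A,B)| * |B⬝C| ≥ (1/(8r)) * min (qʳ|B|/m) (|A||B|²|C|/(m² q^{2r-1}))`. -/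
theorem stmt_5 {R : Type*} [CommRing R] [Fintype R] [IsLocalRing R] [IsPrincipalIdealRing R]
    (z : R) (hz : IsLocalRing.maximalIdeal R = Ideal.span {z})
    (r : ℕ) (hzr : z ^ r = 0) (hmin : ∀ k < r, z ^ k ≠ 0)
    (q : ℕ) (hq : Nat.card (IsLocalRing.ResidueField R) = q) (hqodd : Odd q)
    (g : Rˣ → Rˣ) (m : ℕ) (hmpos : 0 < m)
    (hmu : ∀ t : Rˣ, Nat.card {x : Rˣ // g x ^ 2 * x = t} ≤ m)
    (A B C : Set Rˣ) (hA : A.Nonempty) (hB : B.Nonempty) (hC : C.Nonempty) :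
    (Nat.card (Set.image2 (fun (x y : Rˣ) => (x : R) * (y : R) * ((g x : R) + (y : R))) A B) : ℝ)
        * (Nat.card ↥((B * C : Set Rˣ)) : ℝ) ≥
      1 / (8 * (r : ℝ)) *
        min ((q : ℝ) ^ r * (Nat.card B : ℝ) / (m : ℝ))
          ((Nat.card A : ℝ) * (Nat.card B : ℝ) ^ 2 * (Nat.card C : ℝ)
            / ((m : ℝ) ^ 2 * (q : ℝ) ^ (2 * r - 1))) := by
  classical
  set N : ℕ := Fintype.card R with hN
  have hNq : N = q ^ r := by rw [hN, card_R z hz r hzr hmin, hq]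
  have hMq : Mk z * q = N := by rw [← hq]; exact Mk_z z hz
  have hr : 1 ≤ r := by
    rcases Nat.eq_zero_or_pos r with h | h
    · subst h; simp at hzr
    · exact h
  have hNpos : 0 < N := Fintype.card_pos
  have hqpos : 0 < q := hqodd.pos
  have hM : N * Mk z = q ^ (2 * r - 1) := by
    apply Nat.eq_of_mul_eq_mul_right hqpos
    rw [mul_assoc, hMq, hNq, ← pow_succ, ← pow_add]
    congr 1
    omega
  set A' := A.toFinset with hA'
  set B' := B.toFinset with hB'
  set C' := C.toFinset with hC'
  set P' := (B * C : Set Rˣ).toFinset with hP'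
  set S' := (Set.image2 (fun (x y : Rˣ) => (x : R) * (y : R) * ((g x : R) + (y : R))) A B).toFinset
    with hS'
  rw [Nat.card_eq_card_toFinset A, Nat.card_eq_card_toFinset B, Nat.card_eq_card_toFinset C,
    Nat.card_eq_card_toFinset (B * C), Nat.card_eq_card_toFinset (Set.image2 _ A B),
    ← hA', ← hB', ← hC', ← hP', ← hS']
  have hApos : 0 < A'.card := Finset.card_pos.2 (by simpa [hA'] using hA)
  have hBpos : 0 < B'.card := Finset.card_pos.2 (by simpa [hB'] using hB)
  have hCpos : 0 < C'.card := Finset.card_pos.2 (by simpa [hC'] using hC)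
  let E : Finset (R × R) := (P' ×ˢ S').image fun e => ((e.1 : R), e.2 * ((e.1⁻¹ : Rˣ) : R))
  have hE : E.card ≤ S'.card * P'.card := by
    refine Finset.card_image_le.trans ?_
    rw [Finset.card_product, mul_comm]
  let au : Rˣ × Rˣ → Rˣ := fun i => i.1 * g i.1 * i.2⁻¹
  let bu : Rˣ × Rˣ → Rˣ := fun i => i.1 * (i.2⁻¹ * i.2⁻¹)
  let L := A' ×ˢ C'
  have hab : ∀ i, au i ^ 2 * (bu i)⁻¹ = g i.1 ^ 2 * i.1 := by
    intro i
    rw [mul_inv_eq_iff_eq_mul]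
    simp only [au, bu, pow_two]
    simp only [mul_comm, mul_left_comm, mul_assoc]
  have hfib : ∀ α β : R,
      (L.filter fun i => ((au i : Rˣ) : R) = α ∧ ((bu i : Rˣ) : R) = β).card ≤ m := by
    intro α β
    rcases (L.filter fun i => ((au i : Rˣ) : R) = α ∧ ((bu i : Rˣ) : R) = β).eq_empty_or_nonempty
      with h | ⟨i0, h0⟩
    · rw [h]; simp
    · simp only [Finset.mem_filter] at h0
      obtain ⟨_, ha0, hb0⟩ := h0
      have hmu' := hmu (au i0 ^ 2 * (bu i0)⁻¹)
      rw [Nat.card_eq_fintype_card, Fintype.card_subtype] at hmu'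
      refine le_trans (Finset.card_le_card_of_injOn (fun i => i.1) ?_ ?_) hmu'
      · intro i hi
        simp only [Finset.coe_filter, Set.mem_ofPred_eq, Finset.mem_univ, true_and] at hi ⊢
        have h1 : au i = au i0 := Units.ext (hi.2.1.trans ha0.symm)
        have h2 : bu i = bu i0 := Units.ext (hi.2.2.trans hb0.symm)
        rw [← h1, ← h2, hab]
      · intro i hi j hj hij
        simp only [Finset.coe_filter, Set.mem_ofPred_eq] at hi hj
        have h1 : au i = au j := Units.ext (hi.2.1.trans hj.2.1.symm)
        simp only at hij
        refine Prod.ext hij ?_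
        simp only [au, hij] at h1
        simpa using h1
  have hinc := incidence z hz r hzr L (fun i => ((au i : Rˣ) : R)) (fun i => ((bu i : Rˣ) : R)) m
    (by convert hfib) E
  have hI : L.card * B'.card ≤
      ∑ e ∈ E, (L.filter fun i => e.2 = ((au i : Rˣ) : R) + ((bu i : Rˣ) : R) * e.1).card := by
    simp_rw [Finset.card_filter]
    rw [Finset.sum_comm]
    simp_rw [← Finset.card_filter]
    rw [← smul_eq_mul]
    refine Finset.card_nsmul_le_sum _ _ _ ?_
    rintro ⟨x, w⟩ hi
    simp only [L, Finset.mem_product, hA', hC', Set.mem_toFinset] at hi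
    refine Finset.card_le_card_of_injOn
      (fun y => (((y * w : Rˣ) : R), (x : R) * y * (g x + y) * (((y * w)⁻¹ : Rˣ) : R))) ?_ ?_
    · intro y hy
      have hy' : y ∈ B := by simpa [hB'] using hy
      simp only [Finset.coe_filter, Set.mem_ofPred_eq]
      refine ⟨?_, ?_⟩
      · apply Finset.mem_image.2
        refine ⟨(y * w, (x : R) * y * (g x + y)), ?_, rfl⟩
        rw [Finset.mem_product]
        constructor
        · simp only [hP', Set.mem_toFinset]
          exact Set.mul_mem_mul hy' hi.2
        · simp only [hS', Set.mem_toFinset]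
          exact Set.mem_image2_of_mem hi.1 hy'
      · rw [Units.mul_inv_eq_iff_eq_mul]
        simp only [au, bu, Units.val_mul]
        have hw : (w : R) * ((w⁻¹ : Rˣ) : R) = 1 := Units.mul_inv w
        generalize ((w⁻¹ : Rˣ) : R) = v at hw
        linear_combination (-(x : R) * g x * y - x * y * y * (1 + w * v)) * hw
    · intro y _ y' _ hyy
      simp only [Prod.mk.injEq] at hyy
      have := Units.ext hyy.1
      simpa using this
  have hLc : L.card = A'.card * C'.card := Finset.card_product _ _
  have hI' : (L.card : ℝ) * B'.card ≤ ∑ e ∈ E,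
      ((L.filter fun i => e.2 = ((au i : Rˣ) : R) + ((bu i : Rˣ) : R) * e.1).card : ℝ) := by
    exact_mod_cast hI
  have hinc' : ((∑ e ∈ E,
      ((L.filter fun i => e.2 = ((au i : Rˣ) : R) + ((bu i : Rˣ) : R) * e.1).card : ℝ))
      - E.card * L.card / N) ^ 2 ≤ E.card * (L.card * (m * (r * (N * Mk z)))) := by
    convert hinc
  have hM' : (N : ℝ) * Mk z = (q : ℝ) ^ (2 * r - 1) := by exact_mod_cast hM
  rw [hM'] at hinc'
  generalize (∑ e ∈ E,
      ((L.filter fun i => e.2 = ((au i : Rˣ) : R) + ((bu i : Rˣ) : R) * e.1).card : ℝ)) = I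
    at hI' hinc'
  have hNq' : (N : ℝ) = (q : ℝ) ^ r := by exact_mod_cast hNq
  have hE' : (E.card : ℝ) ≤ (S'.card : ℝ) * P'.card := by exact_mod_cast hE
  have hLc' : (L.card : ℝ) = A'.card * C'.card := by exact_mod_cast hLc
  have hL0 : (0 : ℝ) < L.card := by rw [hLc']; positivity
  refine ge_iff_le.2 (le_trans ?_ hE')
  rw [← hNq']
  have h4 : (A'.card : ℝ) * B'.card ^ 2 * C'.card = L.card * B'.card ^ 2 := by rw [hLc']; ring
  rw [h4]
  have hD : (0 : ℝ) < (q : ℝ) ^ (2 * r - 1) := by positivity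
  generalize (q : ℝ) ^ (2 * r - 1) = D at hD hinc'
  have hb : (0 : ℝ) < B'.card := by exact_mod_cast hBpos
  have hNr : (0 : ℝ) < N := by exact_mod_cast hNpos
  have hmr : (1 : ℝ) ≤ m := by exact_mod_cast hmpos
  have hrr : (1 : ℝ) ≤ r := by exact_mod_cast hr
  have hE0 : (0 : ℝ) ≤ E.card := by positivity
  exact final_arith _ _ _ _ _ _ _ _ hE0 hL0 hb hNr hmr hrr hD hI' hinc'
end

section
/- Let R be a finite valuation ring with uniformizer z, nilpotency degree r, and residue field of odd cardinality q, and let M be the adjacency matrix of the sum-product graph SP_R, i.e. the real symmetric matrix indexed by R × R with M[(a,b),(c,d)] = 1 if a + c = b·d and 0 otherwise. Then for every real number θ and every nonzero vector v : R × R → ℝ satisfying M·v = θ·v and Σ_{p ∈ R×R} v(p) = 0 (v is orthogonal to the all-ones vector), one has θ^2 ≤ 2·r·q^{2r-1}. -/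
open IsLocalRing in
lemma card_span_aux {R : Type*} [CommRing R] [Finite R] [IsLocalRing R]
    (z : R) (hz : maximalIdeal R = Ideal.span {z}) (k : ℕ) :
    Nat.card (Ideal.span {z ^ k} : Ideal R) ≤
      Nat.card (ResidueField R) * Nat.card (Ideal.span {z ^ (k + 1)} : Ideal R) := by
  have : Finite (ResidueField R) := Finite.of_surjective _ (residue_surjective (R := R))
  rw [← Nat.card_prod]
  obtain ⟨s, hs⟩ := (residue_surjective (R := R)).hasRightInverse
  have hle : (Ideal.span {z ^ (k + 1)} : Ideal R) ≤ Ideal.span {z ^ k} := by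
    rw [Ideal.span_singleton_le_span_singleton]
    exact pow_dvd_pow z (Nat.le_succ k)
  let f : ResidueField R × (Ideal.span {z ^ (k + 1)} : Ideal R) → (Ideal.span {z ^ k} : Ideal R) :=
    fun t => ⟨s t.1 * z ^ k + t.2.1,
      Ideal.add_mem _ (Ideal.mul_mem_left _ _ (Ideal.mem_span_singleton_self _)) (hle t.2.2)⟩
  apply Nat.card_le_card_of_surjective f
  rintro ⟨y, hy⟩
  obtain ⟨x, hx⟩ := Ideal.mem_span_singleton'.1 hy
  have h1 : x - s (residue R x) ∈ maximalIdeal R := by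
    rw [← residue_eq_zero_iff, map_sub, hs, sub_self]
  rw [hz] at h1
  obtain ⟨w, hw⟩ := Ideal.mem_span_singleton'.1 h1
  refine ⟨(residue R x, ⟨w * z ^ (k + 1), Ideal.mul_mem_left _ _
    (Ideal.mem_span_singleton_self _)⟩), ?_⟩
  apply Subtype.ext
  show s (residue R x) * z ^ k + w * z ^ (k + 1) = y
  rw [← hx]
  linear_combination z ^ k * hw

open IsLocalRing in
lemma card_span_le {R : Type*} [CommRing R] [Finite R] [IsLocalRing R]
    (z : R) (hz : maximalIdeal R = Ideal.span {z}) (j : ℕ) :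
    ∀ k, z ^ (k + j) = 0 →
      Nat.card (Ideal.span {z ^ k} : Ideal R) ≤ Nat.card (ResidueField R) ^ j := by
  induction j with
  | zero =>
    intro k hk
    have : (Ideal.span {z ^ k} : Ideal R) = ⊥ := by
      rw [add_zero] at hk
      rw [hk]; simp
    rw [this]; simp
  | succ j ih =>
    intro k hk
    refine (card_span_aux z hz k).trans ?_
    rw [pow_succ' (Nat.card (ResidueField R)) j]
    have hk' : z ^ (k + 1 + j) = 0 := by
      rw [show k + 1 + j = k + (j + 1) by omega]
      exact hk
    have h := ih (k + 1) hk'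
    generalize Nat.card (ResidueField R) = A at *
    exact Nat.mul_le_mul_left A h

/-- **Lemma 3.2 (spectral gap of the sum-product graph).**  Let `R` be a finite valuation
ring with uniformizer `z`, nilpotency degree `r`, residue field of odd cardinality `q`,
and let `M` be the adjacency matrix of the sum-product graph on `R × R` (with `(a,b)`
adjacent to `(c,d)` iff `a + c = b * d`).  Every eigenvalue `θ` of `M` whose eigenvector
is orthogonal to the all-ones vector satisfies `θ² ≤ 2 r q^{2r-1}`. -/
theorem stmt_6 {R : Type*} [CommRing R] [Fintype R] [DecidableEq R]
    [IsLocalRing R] [IsPrincipalIdealRing R]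
    (z : R) (hz : IsLocalRing.maximalIdeal R = Ideal.span {z})
    (r : ℕ) (hzr : z ^ r = 0) (hmin : ∀ k < r, z ^ k ≠ 0)
    (q : ℕ) (hq : Nat.card (IsLocalRing.ResidueField R) = q) (hqodd : Odd q)
    (M : Matrix (R × R) (R × R) ℝ)
    (hM : ∀ p p' : R × R, M p p' = if p.1 + p'.1 = p.2 * p'.2 then 1 else 0)
    (θ : ℝ) (v : R × R → ℝ) (hv : v ≠ 0)
    (heig : M.mulVec v = θ • v) (horth : ∑ p : R × R, v p = 0) :
    θ ^ 2 ≤ 2 * (r : ℝ) * (q : ℝ) ^ (2 * r - 1) := by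
  classical
  have hr : 1 ≤ r := by
    rcases Nat.eq_zero_or_pos r with h | h
    · subst h; simp at hzr
    · exact h
  have hcR : (Fintype.card R : ℝ) ≤ (q : ℝ) ^ r := by
    have h := card_span_le z hz r 0 (by simpa using hzr)
    rw [hq, pow_zero, Ideal.span_singleton_one] at h
    have h2 : Nat.card (⊤ : Ideal R) = Fintype.card R := by
      rw [← Nat.card_eq_fintype_card]
      exact Nat.card_congr (Equiv.Set.univ R)
    rw [h2] at h
    exact_mod_cast h
  have hcm : ((Finset.univ.filter (fun x : R => ¬ IsUnit x)).card : ℝ) ≤ (q : ℝ) ^ (r - 1) := by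
    have h := card_span_le z hz (r - 1) 1 (by rw [Nat.add_sub_cancel' hr]; exact hzr)
    rw [hq, pow_one, ← hz] at h
    have h2 : Nat.card (IsLocalRing.maximalIdeal R)
        = (Finset.univ.filter (fun x : R => ¬ IsUnit x)).card := by
      rw [← Fintype.card_subtype, ← Nat.card_eq_fintype_card]
      exact Nat.card_congr (Equiv.subtypeEquivRight fun x => IsLocalRing.mem_maximalIdeal x)
    rw [h2] at h
    exact_mod_cast h
  -- the entries of the square
  have hK : ∀ a b c d : R, (M * M) (a, b) (c, d) =
      ∑ y : R, if b * y - a + c = y * d then (1 : ℝ) else 0 := by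
    intro a b c d
    rw [Matrix.mul_apply, Fintype.sum_prod_type, Finset.sum_comm]
    refine Finset.sum_congr rfl fun y _ => ?_
    rw [Finset.sum_eq_single (b * y - a)]
    · simp [hM]
    · intro x _ hx
      rw [hM, if_neg, zero_mul]
      intro h
      exact hx (by linear_combination h)
    · simp
  have hK0 : ∀ p p', 0 ≤ (M * M) p p' := by
    rintro ⟨a, b⟩ ⟨c, d⟩
    rw [hK]
    exact Finset.sum_nonneg fun y _ => by split_ifs <;> norm_num
  have hKu : ∀ a b c d : R, IsUnit (b - d) → (M * M) (a, b) (c, d) = 1 := by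
    intro a b c d hu
    obtain ⟨w, hw⟩ := hu.exists_right_inv
    rw [hK, Finset.sum_eq_single (w * (a - c))]
    · rw [if_pos]
      linear_combination (a - c) * hw
    · intro y _ hy
      rw [if_neg]
      intro h
      apply hy
      linear_combination w * h - y * hw
    · simp
  have hKs : ∀ a b d : R, ∑ c : R, (M * M) (a, b) (c, d) = Fintype.card R := by
    intro a b d
    simp_rw [hK]
    rw [Finset.sum_comm]
    have : ∀ y : R, (∑ c : R, if b * y - a + c = y * d then (1 : ℝ) else 0) = 1 := by
      intro y
      rw [Finset.sum_eq_single (y * d - (b * y - a))]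
      · rw [if_pos]; ring
      · intro c _ hc
        rw [if_neg]
        intro h
        exact hc (by linear_combination h)
      · simp
    simp [this]
  have hrow : ∀ p : R × R, ∑ p', |(M * M) p p' - 1| ≤ 2 * (q : ℝ) ^ (2 * r - 1) := by
    rintro ⟨a, b⟩
    rw [Fintype.sum_prod_type, Finset.sum_comm]
    have h1 : ∀ d : R, ∑ c : R, |(M * M) (a, b) (c, d) - 1| ≤
        if ¬ IsUnit (b - d) then 2 * (Fintype.card R : ℝ) else 0 := by
      intro d
      by_cases hu : IsUnit (b - d)
      · simp [hu, hKu a b _ d hu]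
      · rw [if_pos hu]
        calc ∑ c : R, |(M * M) (a, b) (c, d) - 1| ≤ ∑ c : R, ((M * M) (a, b) (c, d) + 1) := by
              refine Finset.sum_le_sum fun c _ => ?_
              have := hK0 (a, b) (c, d)
              rw [abs_le]; constructor <;> linarith
          _ = 2 * (Fintype.card R : ℝ) := by
              rw [Finset.sum_add_distrib, hKs]; simp; ring
    calc _ ≤ ∑ d : R, if ¬ IsUnit (b - d) then 2 * (Fintype.card R : ℝ) else 0 :=
          Finset.sum_le_sum fun d _ => h1 d
      _ = ∑ d : R, if ¬ IsUnit d then 2 * (Fintype.card R : ℝ) else 0 :=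
          Equiv.sum_comp (Equiv.subLeft b)
            (fun d => if ¬ IsUnit d then 2 * (Fintype.card R : ℝ) else 0)
      _ = ((Finset.univ.filter (fun x : R => ¬ IsUnit x)).card : ℝ) * (2 * Fintype.card R) := by
          rw [← Finset.sum_filter, Finset.sum_const, nsmul_eq_mul]
      _ ≤ (q : ℝ) ^ (r - 1) * (2 * (q : ℝ) ^ r) := by gcongr
      _ = 2 * (q : ℝ) ^ (2 * r - 1) := by
          rw [show 2 * r - 1 = (r - 1) + r by omega, pow_add]; ring
  have hsq : ∀ p, θ ^ 2 * v p = ∑ p', ((M * M) p p' - 1) * v p' := by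
    intro p
    have h : (M * M).mulVec v = θ ^ 2 • v := by
      rw [← Matrix.mulVec_mulVec, heig, Matrix.mulVec_smul, heig, smul_smul, sq]
    have h2 := congrFun h p
    simp only [Matrix.mulVec, dotProduct, Pi.smul_apply, smul_eq_mul] at h2
    simp_rw [sub_mul, one_mul]
    rw [Finset.sum_sub_distrib, horth, sub_zero, h2]
  obtain ⟨p, -, hp⟩ := Finset.exists_max_image Finset.univ (fun p => |v p|) Finset.univ_nonempty
  have hpos : 0 < |v p| := by
    obtain ⟨p0, h0⟩ := Function.ne_iff.1 hv
    exact (abs_pos.2 h0).trans_le (hp p0 (Finset.mem_univ _))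
  have hmain : θ ^ 2 * |v p| ≤ 2 * (q : ℝ) ^ (2 * r - 1) * |v p| := by
    calc θ ^ 2 * |v p| = |∑ p', ((M * M) p p' - 1) * v p'| := by
          rw [← hsq, abs_mul, abs_of_nonneg (sq_nonneg θ)]
      _ ≤ ∑ p', |((M * M) p p' - 1) * v p'| := Finset.abs_sum_le_sum_abs _ _
      _ ≤ ∑ p', |(M * M) p p' - 1| * |v p| := by
          refine Finset.sum_le_sum fun p' _ => ?_
          rw [abs_mul]
          exact mul_le_mul_of_nonneg_left (hp p' (Finset.mem_univ _)) (abs_nonneg _)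
      _ = (∑ p', |(M * M) p p' - 1|) * |v p| := by rw [Finset.sum_mul]
      _ ≤ _ := mul_le_mul_of_nonneg_right (hrow p) hpos.le
  have h3 := le_of_mul_le_mul_right hmain hpos
  refine h3.trans ?_
  have hr' : (1 : ℝ) ≤ r := by exact_mod_cast hr
  have hq0 : (0 : ℝ) ≤ (q : ℝ) ^ (2 * r - 1) := by positivity
  nlinarith
end

section
/- Let R be a finite valuation ring with uniformizer z, nilpotency degree r, and residue field of cardinality q. For all (a,b), (c,d) ∈ R × R, the number of common neighbors of (a,b) and (c,d) in the sum-product graph, i.e. the number of pairs (u,v) ∈ R × R with a + u = b·v and c + u = d·v, equals q^{ν(b-d)} if a − c lies in the ideal generated by b − d, and equals 0 otherwise. -/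
open Classical

/-- The natural valuation on a finite valuation ring with uniformizer `z` and nilpotency
degree `r`: `ν 0 = r`, and for `x ≠ 0`, `ν x` is the unique `k` with
`x ∈ (z^k) \ (z^(k+1))`, i.e. the least `k` with `x ∉ (z^(k+1))`. -/
noncomputable def nuVal {R : Type*} [CommRing R] (z : R) (r : ℕ) (x : R) : ℕ :=
  if x = 0 then r else sInf {k : ℕ | x ∉ Ideal.span {z ^ (k + 1)}}

/-- Annihilator of an element, as the kernel of multiplication. -/
noncomputable def annK {R : Type*} [CommRing R] (x : R) : Submodule R R :=
  LinearMap.ker (LinearMap.mulLeft R x)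

theorem mem_annK {R : Type*} [CommRing R] (x v : R) : v ∈ annK x ↔ x * v = 0 := by
  simp [annK]

theorem card_ker_range {R M N : Type*} [CommRing R] [AddCommGroup M] [AddCommGroup N]
    [Module R M] [Module R N] (f : M →ₗ[R] N) :
    Nat.card M = Nat.card (LinearMap.ker f) * Nat.card (LinearMap.range f) := by
  rw [Submodule.card_eq_card_quotient_mul_card (LinearMap.ker f),
    Nat.card_congr f.quotKerEquivRange.toEquiv]

theorem card_annK_z {R : Type*} [CommRing R] [Fintype R] [IsLocalRing R]
    (z : R) (hz : IsLocalRing.maximalIdeal R = Ideal.span {z}) :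
    Nat.card (annK z) = Nat.card (IsLocalRing.ResidueField R) := by
  have h1 := card_ker_range (LinearMap.mulLeft R z)
  have h2 := Submodule.card_eq_card_quotient_mul_card (IsLocalRing.maximalIdeal R)
  have h3 : LinearMap.range (LinearMap.mulLeft R z) = IsLocalRing.maximalIdeal R := by
    rw [hz]
    ext x
    rw [Ideal.mem_span_singleton', LinearMap.mem_range]
    simp [mul_comm]
  rw [h3, h2] at h1
  have hpos : 0 < Nat.card (IsLocalRing.maximalIdeal R) := Nat.card_pos
  have := Nat.eq_of_mul_eq_mul_right hpos ((mul_comm _ _).trans h1)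
  exact this.symm

theorem card_annK_pow {R : Type*} [CommRing R] [Fintype R] [IsLocalRing R]
    (z : R) (hz : IsLocalRing.maximalIdeal R = Ideal.span {z})
    (r : ℕ) (hmin : ∀ k < r, z ^ k ≠ 0) (k : ℕ) (hk : k ≤ r) :
    Nat.card (annK (z ^ k)) = Nat.card (IsLocalRing.ResidueField R) ^ k := by
  induction k with
  | zero =>
    have : annK (z ^ 0) = ⊥ := by
      ext x; simp [mem_annK]
    rw [this]; simp
  | succ k ih =>
    have ih := ih (by omega)
    have h1 := card_ker_range ((LinearMap.mulLeft R z).domRestrict (annK (z ^ (k + 1))))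
    have h2 : LinearMap.range ((LinearMap.mulLeft R z).domRestrict (annK (z ^ (k + 1))))
        = annK (z ^ k) := by
      ext x
      rw [LinearMap.mem_range, mem_annK]
      constructor
      · rintro ⟨⟨y, hy⟩, rfl⟩
        rw [mem_annK] at hy
        simp only [LinearMap.domRestrict_apply, LinearMap.mulLeft_apply]
        rw [← mul_assoc, ← pow_succ]; exact hy
      · intro hx
        have hm : x ∈ IsLocalRing.maximalIdeal R := by
          rw [IsLocalRing.mem_maximalIdeal, mem_nonunits_iff]
          intro hu
          exact hmin k (by omega) ((hu.mul_left_eq_zero).1 hx)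
        rw [hz, Ideal.mem_span_singleton'] at hm
        obtain ⟨y, rfl⟩ := hm
        refine ⟨⟨y, ?_⟩, ?_⟩
        · rw [mem_annK, pow_succ, mul_assoc, mul_comm z y]; exact hx
        · simp [mul_comm]
    have h3 : Nat.card (LinearMap.ker
        ((LinearMap.mulLeft R z).domRestrict (annK (z ^ (k + 1))))) = Nat.card (annK z) := by
      refine Nat.card_congr ⟨fun x => ⟨x.1.1, ?_⟩, fun x => ⟨⟨x.1, ?_⟩, ?_⟩, ?_, ?_⟩
      · have := x.2
        rw [LinearMap.mem_ker] at this
        rw [mem_annK]; exact this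
      · have := x.2
        rw [mem_annK] at this
        rw [mem_annK, pow_succ, mul_assoc, this, mul_zero]
      · have := x.2
        rw [mem_annK] at this
        rw [LinearMap.mem_ker]; exact this
      · intro x; rfl
      · intro x; rfl
    rw [h1, h2, h3, ih, card_annK_z z hz, pow_succ, mul_comm]

theorem card_annK {R : Type*} [CommRing R] [Fintype R] [IsLocalRing R]
    (z : R) (hz : IsLocalRing.maximalIdeal R = Ideal.span {z})
    (r : ℕ) (hzr : z ^ r = 0) (hmin : ∀ k < r, z ^ k ≠ 0) (x : R) :
    Nat.card (annK x) = Nat.card (IsLocalRing.ResidueField R) ^ nuVal z r x := by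
  by_cases hx : x = 0
  · have h : nuVal z r x = r := by simp [nuVal, hx]
    rw [h, ← card_annK_pow z hz r hmin r le_rfl, hzr, hx]
  · have h : nuVal z r x = sInf {k : ℕ | x ∉ Ideal.span {z ^ (k + 1)}} := by simp [nuVal, hx]
    have hne : {k : ℕ | x ∉ Ideal.span {z ^ (k + 1)}}.Nonempty := by
      refine ⟨r, ?_⟩
      simp [pow_succ, hzr, hx]
    have hmem := Nat.sInf_mem hne
    have hlt := fun m => @Nat.notMem_of_lt_sInf {k : ℕ | x ∉ Ideal.span {z ^ (k + 1)}} m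
    rw [← h] at hmem hlt
    generalize nuVal z r x = k at *
    have hin : x ∈ Ideal.span {z ^ k} := by
      cases k with
      | zero => simp
      | succ m => simpa using hlt m (by omega)
    rw [Ideal.mem_span_singleton'] at hin
    obtain ⟨u, rfl⟩ := hin
    have hkr : k ≤ r := by
      by_contra hc
      apply hx
      rw [pow_eq_zero_of_le (by omega) hzr, mul_zero]
    have hu : IsUnit u := by
      by_contra hc
      have hm : u ∈ IsLocalRing.maximalIdeal R := by
        rwa [IsLocalRing.mem_maximalIdeal, mem_nonunits_iff]
      rw [hz, Ideal.mem_span_singleton'] at hm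
      obtain ⟨y, rfl⟩ := hm
      apply hmem
      rw [Ideal.mem_span_singleton']
      exact ⟨y, by ring⟩
    rw [← card_annK_pow z hz r hmin k hkr]
    have : annK (u * z ^ k) = annK (z ^ k) := by
      ext v
      rw [mem_annK, mem_annK, mul_assoc, hu.mul_right_eq_zero]
    rw [this]

/-- In the sum-product graph of a finite valuation ring `R`, two vertices `(a, b)` and
`(c, d)` have exactly `q^{ν(b-d)}` common neighbors if `a - c ∈ (b - d)`, and none
otherwise. -/
theorem stmt_9 {R : Type*} [CommRing R] [Fintype R] [IsLocalRing R] [IsPrincipalIdealRing R]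
    (z : R) (hz : IsLocalRing.maximalIdeal R = Ideal.span {z})
    (r : ℕ) (hzr : z ^ r = 0) (hmin : ∀ k < r, z ^ k ≠ 0)
    (q : ℕ) (hq : Nat.card (IsLocalRing.ResidueField R) = q)
    (a b c d : R) :
    Nat.card {p : R × R // a + p.1 = b * p.2 ∧ c + p.1 = d * p.2} =
      if a - c ∈ Ideal.span {b - d} then q ^ nuVal z r (b - d) else 0 := by
  split_ifs with h
  · rw [← hq, ← card_annK z hz r hzr hmin]
    rw [Ideal.mem_span_singleton'] at h
    obtain ⟨w, hw⟩ := h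
    refine Nat.card_congr ⟨fun p => ⟨p.1.2 - w, ?_⟩,
      fun v => ⟨(b * (v.1 + w) - a, v.1 + w), ?_, ?_⟩, ?_, ?_⟩
    · obtain ⟨p, h1, h2⟩ := p
      rw [mem_annK]
      linear_combination h2 - h1 - hw
    · ring
    · have hv := v.2
      rw [mem_annK] at hv
      linear_combination hv + hw
    · rintro ⟨⟨u, v⟩, h1, h2⟩
      simp only [sub_add_cancel, Subtype.mk.injEq, Prod.mk.injEq, and_true]
      linear_combination - h1
    · rintro ⟨v, hv⟩
      simp
  · have : IsEmpty {p : R × R // a + p.1 = b * p.2 ∧ c + p.1 = d * p.2} := by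
      refine ⟨fun ⟨p, h1, h2⟩ => h ?_⟩
      rw [Ideal.mem_span_singleton']
      exact ⟨p.2, by linear_combination h2 - h1⟩
    exact Nat.card_of_isEmpty
end

section
/- Let R be a finite valuation ring, let G be a subgroup of the unit group R^*, let g, h : G → R^* be functions, and let K be a positive integer such that for every u ∈ G, μ(x ↦ g(x)·h(u·x)·x) ≤ K. Then for every quadruple (u,v,w,t) of units of R, the number of triples (x,y,z) ∈ G × G × G satisfying the system g(x)·h(y)·(x+y) = u·h(y·z), y·z = v, x·z = w, and t·g(x)·h(y) = z·h(y·z) is at most K. -/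
/-- **Counting step in the proof of Theorem 1.12.**  Let `R` be a finite valuation ring,
`G ≤ Rˣ`, `g h : G → Rˣ` with `μ(x ↦ g x * h (u x) * x) ≤ K` for all `u ∈ G`.  For every
quadruple `(u, v, w, t)` of units, the system `g x * h y * (x + y) = u * h (y z)`,
`y z = v`, `x z = w`, `t * g x * h y = z * h (y z)` has at most `K` solutions
`(x, y, z) ∈ G × G × G`. -/
theorem stmt_13 {R : Type*} [CommRing R] [Fintype R] [IsLocalRing R] [IsPrincipalIdealRing R]
    (G : Subgroup Rˣ) (g h : G → Rˣ) (K : ℕ) (hKpos : 0 < K)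
    (hmu : ∀ u : G, ∀ t : Rˣ, Nat.card {x : G // g x * h (u * x) * (x : Rˣ) = t} ≤ K)
    (u v w t : Rˣ) :
    Nat.card {p : G × G × G //
        (g p.1 : R) * (h p.2.1 : R) * (((p.1 : Rˣ) : R) + ((p.2.1 : Rˣ) : R)) =
            (u : R) * (h (p.2.1 * p.2.2) : R) ∧
        ((p.2.1 * p.2.2 : G) : Rˣ) = v ∧ ((p.1 * p.2.2 : G) : Rˣ) = w ∧
        t * g p.1 * h p.2.1 = ((p.2.2 : Rˣ)) * h (p.2.1 * p.2.2)} ≤ K := by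
  classical
  by_cases hv : v ∈ G
  swap
  · have : IsEmpty {p : G × G × G //
        (g p.1 : R) * (h p.2.1 : R) * (((p.1 : Rˣ) : R) + ((p.2.1 : Rˣ) : R)) =
            (u : R) * (h (p.2.1 * p.2.2) : R) ∧
        ((p.2.1 * p.2.2 : G) : Rˣ) = v ∧ ((p.1 * p.2.2 : G) : Rˣ) = w ∧
        t * g p.1 * h p.2.1 = ((p.2.2 : Rˣ)) * h (p.2.1 * p.2.2)} :=
      ⟨fun p => hv (p.2.2.1 ▸ (p.1.2.1 * p.1.2.2 : G).2)⟩
    rw [Nat.card_of_isEmpty]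
    exact Nat.zero_le _
  by_cases hw : w ∈ G
  swap
  · have : IsEmpty {p : G × G × G //
        (g p.1 : R) * (h p.2.1 : R) * (((p.1 : Rˣ) : R) + ((p.2.1 : Rˣ) : R)) =
            (u : R) * (h (p.2.1 * p.2.2) : R) ∧
        ((p.2.1 * p.2.2 : G) : Rˣ) = v ∧ ((p.1 * p.2.2 : G) : Rˣ) = w ∧
        t * g p.1 * h p.2.1 = ((p.2.2 : Rˣ)) * h (p.2.1 * p.2.2)} :=
      ⟨fun p => hw (p.2.2.2.1 ▸ (p.1.1 * p.1.2.2 : G).2)⟩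
    rw [Nat.card_of_isEmpty]
    exact Nat.zero_le _
  refine le_trans ?_ (hmu (⟨v, hv⟩ * (⟨w, hw⟩ : G)⁻¹) (t⁻¹ * w * h ⟨v, hv⟩))
  refine Nat.card_le_card_of_injective (fun p => ⟨p.1.1, ?_⟩) ?_
  · obtain ⟨⟨x, y, z⟩, -, h1, h2, h3⟩ := p
    dsimp only at h1 h2 h3 ⊢
    have e1 : (⟨v, hv⟩ : G) = y * z := Subtype.ext h1.symm
    have e2 : (⟨w, hw⟩ : G) = x * z := Subtype.ext h2.symm
    have e3 : y * z * (x * z)⁻¹ * x = y := by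
      rw [mul_inv_rev, mul_assoc y z, mul_inv_cancel_left, inv_mul_cancel_right]
    rw [e1, e2, e3, ← h2, mul_assoc t⁻¹, eq_inv_mul_iff_mul_eq, ← mul_assoc, ← mul_assoc, h3,
      Subgroup.coe_mul, mul_comm, mul_assoc]
  · rintro ⟨⟨x, y, z⟩, h0, h1, h2, h3⟩ ⟨⟨x', y', z'⟩, h0', h1', h2', h3'⟩ hx
    have hx' : x = x' := congrArg Subtype.val hx
    subst hx'
    have hz : z = z' := mul_left_cancel (Subtype.ext (h2.trans h2'.symm))
    subst hz
    have hy : y = y' := mul_right_cancel (Subtype.ext (h1.trans h1'.symm))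
    subst hy
    rfl
end
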